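/- arXiv:1705.01360 — 3 statements merged into one kernel-verified Lean document; each statement's English description precedes it below -/
import Mathlib

section
/- Let X be an Ahlfors Q-regular metric measure space, let ∅ ≠ E ⊂ X be a closed set with dim_A(E) < Q, let α ∈ ℝ, let 1 < p < ∞, and set w = δ_E^{-α}. Then w belongs to the Muckenhoupt class A_p if and only if (1−p)(Q − dim_A(E)) < α < Q − dim_A(E). -/
open MeasureTheory Metric Set
open scoped ENNReal NNReal

namespace ApDistance

noncomputable section

variable {X : Type*} [MetricSpace X] [MeasurableSpace X] [BorelSpace X]

/-- All balls of positive radius have positive and finite measure. -/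
def BallsPosFinite (μ : Measure X) : Prop :=
  ∀ (x : X) (r : ℝ), 0 < r → 0 < μ (ball x r) ∧ μ (ball x r) < ∞

/-- The measure `μ` is doubling with constant `C`. -/
def DoublingWith (μ : Measure X) (C : ℝ) : Prop :=
  ∀ (x : X) (r : ℝ), 0 < r → μ (ball x (2 * r)) ≤ ENNReal.ofReal C * μ (ball x r)

/-- The measure `μ` is doubling. -/
def Doubling (μ : Measure X) : Prop :=
  ∃ C : ℝ, 0 < C ∧ DoublingWith μ C

/-- The (quantitative) reverse doubling condition with exponent `η`. -/
def ReverseDoubling (μ : Measure X) (η : ℝ) : Prop :=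
  ∃ C : ℝ, 0 < C ∧ ∀ (x y : X) (r R : ℝ), 0 < r → 0 < R → ball y r ⊆ ball x R →
    μ (ball y r) ≤ ENNReal.ofReal (C * (r / R) ^ η) * μ (ball x R)

/-- Standing assumptions (S1)-(S2): `X` is unbounded, points have measure zero,
and all annuli are nonempty. -/
def StandingAssumptions (μ : Measure X) : Prop :=
  ¬ Bornology.IsBounded (univ : Set X) ∧ (∀ x : X, μ {x} = 0) ∧
    ∀ (x : X) (r R : ℝ), 0 < r → r < R → (ball x R \ ball x r).Nonempty

/-- Ahlfors `Q`-regularity of the metric measure space. -/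
def AhlforsRegular (μ : Measure X) (Q : ℝ) : Prop :=
  ∃ C : ℝ, 1 ≤ C ∧ ∀ (x : X) (r : ℝ), 0 < r → ENNReal.ofReal r < EMetric.diam (univ : Set X) →
    ENNReal.ofReal (C⁻¹ * r ^ Q) ≤ μ (ball x r) ∧ μ (ball x r) ≤ ENNReal.ofReal (C * r ^ Q)

/-- The set of admissible exponents in the definition of the (upper) Assouad dimension:
`E ∩ B(x,R)` can be covered by at most `C (R/r)^s` balls of radius `r`. -/
def assouadDimBddSet (E : Set X) : Set ℝ :=
  {s : ℝ | 0 ≤ s ∧ ∃ C : ℝ, 1 ≤ C ∧ ∀ x ∈ E, ∀ r R : ℝ, 0 < r → r < R →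
    ENNReal.ofReal R < 2 * EMetric.diam (univ : Set X) →
    ∃ F : Finset X, (F.card : ℝ) ≤ C * (R / r) ^ s ∧ E ∩ ball x R ⊆ ⋃ y ∈ F, ball y r}

/-- The (upper) Assouad dimension of a set `E`. -/
def assouadDim (E : Set X) : ℝ := sInf (assouadDimBddSet E)

/-- The set of admissible exponents in the definition of the lower Assouad codimension. -/
def assouadCodimBddSet (μ : Measure X) (E : Set X) : Set ℝ :=
  {ρ : ℝ | 0 ≤ ρ ∧ ∃ C : ℝ, 1 ≤ C ∧ ∀ x ∈ E, ∀ r R : ℝ, 0 < r → r < R →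
    ENNReal.ofReal R < 2 * EMetric.diam (univ : Set X) →
    μ ({y : X | infDist y E < r} ∩ ball x R) ≤
      ENNReal.ofReal (C * (r / R) ^ ρ) * μ (ball x R)}

/-- The lower Assouad codimension of a set `E` with respect to `μ`. -/
def assouadCodim (μ : Measure X) (E : Set X) : ℝ := sSup (assouadCodimBddSet μ E)

/-- Porosity of a set `E ⊆ X`. -/
def IsPorous (E : Set X) : Prop :=
  ∃ c : ℝ, 0 < c ∧ c < 1 ∧ ∀ x ∈ E, ∀ r : ℝ, 0 < r →
    ENNReal.ofReal r < 2 * EMetric.diam (univ : Set X) →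
    ∃ y : X, ball y (c * r) ⊆ ball x r \ E

/-- A weight: measurable, a.e. positive and finite, locally integrable on balls. -/
def IsWeight (μ : Measure X) (w : X → ℝ≥0∞) : Prop :=
  Measurable w ∧ (∀ᵐ x ∂μ, 0 < w x ∧ w x ≠ ∞) ∧
    ∀ (x : X) (r : ℝ), 0 < r → ∫⁻ y in ball x r, w y ∂μ ≠ ∞

/-- Membership in the Muckenhoupt class `A_p`, `1 < p < ∞`. -/
def MemAp (μ : Measure X) (w : X → ℝ≥0∞) (p : ℝ) : Prop :=
  IsWeight μ w ∧ ∃ A : ℝ, 0 < A ∧ ∀ (x : X) (r : ℝ), 0 < r →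
    ((∫⁻ y in ball x r, w y ∂μ) / μ (ball x r)) *
      ((∫⁻ y in ball x r, w y ^ (-(1 / (p - 1))) ∂μ) / μ (ball x r)) ^ (p - 1) ≤
      ENNReal.ofReal A

/-- Membership in the Muckenhoupt class `A_1`. -/
def MemA1 (μ : Measure X) (w : X → ℝ≥0∞) : Prop :=
  IsWeight μ w ∧ ∃ A : ℝ, 0 < A ∧ ∀ (x : X) (r : ℝ), 0 < r →
    ((∫⁻ y in ball x r, w y ∂μ) / μ (ball x r)) *
      essSup (fun y => (w y)⁻¹) (μ.restrict (ball x r)) ≤ ENNReal.ofReal A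

/-- Membership in the Muckenhoupt class `A_∞`. -/
def MemAinfty (μ : Measure X) (w : X → ℝ≥0∞) : Prop :=
  IsWeight μ w ∧ ∃ C d : ℝ, 0 < C ∧ 0 < d ∧ ∀ (x : X) (r : ℝ), 0 < r →
    ∀ F : Set X, MeasurableSet F → F ⊆ ball x r →
      ∫⁻ y in F, w y ∂μ ≤
        ENNReal.ofReal C * (μ F / μ (ball x r)) ^ d * ∫⁻ y in ball x r, w y ∂μ

/-- The weight `w = δ_E^{-α} = dist(·,E)^{-α}` (with values in `ℝ≥0∞`). -/
def distWeight (E : Set X) (α : ℝ) : X → ℝ≥0∞ :=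
  fun x => ENNReal.ofReal (infDist x E) ^ (-α)

/-- The Aikawa condition with exponent `α` and constant `C`. -/
def AikawaCondition (μ : Measure X) (E : Set X) (α C : ℝ) : Prop :=
  ∀ x ∈ E, ∀ r : ℝ, 0 < r → ENNReal.ofReal r < 2 * EMetric.diam (univ : Set X) →
    ∫⁻ y in ball x r, ENNReal.ofReal (infDist y E) ^ (-α) ∂μ ≤
      ENNReal.ofReal (C * r ^ (-α)) * μ (ball x r)

/-- The Riesz potential `I_s f`. -/
def rieszPotential (μ : Measure X) (s : ℝ) (f : X → ℝ≥0∞) (x : X) : ℝ≥0∞ :=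
  ∫⁻ y, f y * ENNReal.ofReal (dist x y ^ s) / μ (ball x (dist x y)) ∂μ

/-- `Lip_0(X)`: Lipschitz functions vanishing outside some ball. -/
def MemLip0 (f : X → ℝ) : Prop :=
  (∃ K : ℝ≥0, LipschitzWith K f) ∧ ∃ (x : X) (r : ℝ), ∀ y : X, y ∉ ball x r → f y = 0

/-- The `λ`-chain condition. -/
def ChainCondition (X : Type*) [MetricSpace X] (lam : ℝ) : Prop :=
  ∃ M : ℝ, 1 ≤ M ∧ ∀ (x : X) (r R : ℝ), 0 < r → r < R →
    ∃ (k : ℕ) (c : ℕ → X) (ρ : ℕ → ℝ),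
      (∀ i ≤ k, 0 < ρ i) ∧
      ball (c 0) (lam * ρ 0) ⊆ (ball x R)ᶜ ∧
      ball (c k) (lam * ρ k) ⊆ ball x r ∧
      (∀ i ≤ k,
        M⁻¹ * Metric.diam (ball (c i) (lam * ρ i)) ≤ infDist x (ball (c i) (lam * ρ i)) ∧
        infDist x (ball (c i) (lam * ρ i)) ≤ M * Metric.diam (ball (c i) (lam * ρ i))) ∧
      (∀ i < k, ∃ (z : X) (t : ℝ), 0 < t ∧
        ball z t ⊆ ball (c i) (ρ i) ∩ ball (c (i + 1)) (ρ (i + 1)) ∧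
        ball (c i) (ρ i) ∪ ball (c (i + 1)) (ρ (i + 1)) ⊆ ball z (M * t)) ∧
      (∀ y : X, (({i : ℕ | i ≤ k ∧ y ∈ ball (c i) (lam * ρ i)}).ncard : ℝ) ≤ M)

/-- The inner integral appearing in fractional Hardy–Sobolev inequalities:
`y ↦ ∫_X |f(y)-f(z)|^t / (d(y,z)^{st} μ(B(y,d(y,z)))) dμ(z)`. -/
def fracEnergyKernel (μ : Measure X) (s t : ℝ) (f : X → ℝ) (y : X) : ℝ≥0∞ :=
  ∫⁻ z, ENNReal.ofReal (|f y - f z| ^ t) /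
    (ENNReal.ofReal (dist y z ^ (s * t)) * μ (ball y (dist y z))) ∂μ


set_option linter.unusedSectionVars false
set_option linter.deprecated false

lemma exists_mass_bounds [Nontrivial X] (μ : Measure X) (Q : ℝ) (hQ : 0 < Q)
    (hdbl : Doubling μ) (hreg : AhlforsRegular μ Q) :
    ∃ U L : ℝ, 0 < U ∧ 0 < L ∧
      (∀ (x : X) (r : ℝ), 0 < r → μ (ball x r) ≤ ENNReal.ofReal (U * r ^ Q)) ∧
      (∀ (x : X) (r : ℝ), 0 < r → ENNReal.ofReal r < 8 * EMetric.diam (univ : Set X) →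
        ENNReal.ofReal (L * r ^ Q) ≤ μ (ball x r)) := by
  obtain ⟨D, hD, hdb⟩ := hdbl
  obtain ⟨C, hC, hr⟩ := hreg
  have hC0 : 0 < C := by linarith
  refine ⟨C + D * (D * C), C⁻¹ * (8⁻¹ : ℝ) ^ Q, by positivity, by positivity, ?_, ?_⟩
  · intro x r hr0
    have hrQ : 0 < r ^ Q := Real.rpow_pos_of_pos hr0 Q
    by_cases h : ENNReal.ofReal r < EMetric.diam (univ : Set X)
    · refine ((hr x r hr0 h).2).trans (ENNReal.ofReal_le_ofReal ?_)
      have : 0 < D * (D * C) * r ^ Q := by positivity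
      nlinarith
    · rw [not_lt] at h
      have hfin : EMetric.diam (univ : Set X) ≠ ∞ := ne_top_of_le_ne_top ENNReal.ofReal_ne_top h
      have hpos : EMetric.diam (univ : Set X) ≠ 0 := by
        obtain ⟨a, b, hab⟩ := exists_pair_ne X
        intro h0
        have : edist a b ≤ EMetric.diam (univ : Set X) :=
          Metric.edist_le_ediam_of_mem (mem_univ a) (mem_univ b)
        rw [h0] at this
        exact hab (edist_le_zero.1 this)
      set d := (EMetric.diam (univ : Set X)).toReal with hd
      have hd0 : 0 < d := ENNReal.toReal_pos hpos hfin
      have hdd : ENNReal.ofReal d = EMetric.diam (univ : Set X) := ENNReal.ofReal_toReal hfin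
      have hdr : d ≤ r := by
        rw [← hdd] at h
        exact (ENNReal.ofReal_le_ofReal_iff hr0.le).1 h
      have hsub : ball x r ⊆ ball x (2 * (2 * (d / 2))) := by
        intro y _
        have h1 : edist y x ≤ ENNReal.ofReal d := by
          rw [hdd]; exact Metric.edist_le_ediam_of_mem (mem_univ y) (mem_univ x)
        rw [edist_dist, ENNReal.ofReal_le_ofReal_iff hd0.le] at h1
        rw [mem_ball]; linarith
      have h2 : μ (ball x (d/2)) ≤ ENNReal.ofReal (C * r ^ Q) := by
        have : ENNReal.ofReal (d/2) < EMetric.diam (univ : Set X) := by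
          rw [← hdd]; exact (ENNReal.ofReal_lt_ofReal_iff hd0).2 (by linarith)
        refine ((hr x (d/2) (by positivity) this).2).trans (ENNReal.ofReal_le_ofReal ?_)
        gcongr
        linarith
      calc μ (ball x r) ≤ μ (ball x (2 * (2 * (d / 2)))) := measure_mono hsub
        _ ≤ ENNReal.ofReal D * μ (ball x (2 * (d/2))) := hdb x _ (by positivity)
        _ ≤ ENNReal.ofReal D * (ENNReal.ofReal D * μ (ball x (d/2))) := by
            gcongr; exact hdb x _ (by positivity)
        _ ≤ ENNReal.ofReal D * (ENNReal.ofReal D * ENNReal.ofReal (C * r ^ Q)) := by gcongr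
        _ = ENNReal.ofReal (D * (D * (C * r ^ Q))) := by
            rw [ENNReal.ofReal_mul hD.le, ENNReal.ofReal_mul hD.le]
        _ ≤ _ := by
            apply ENNReal.ofReal_le_ofReal
            have : 0 < C * r ^ Q := by positivity
            nlinarith
  · intro x r hr0 h
    have h8 : ENNReal.ofReal (8⁻¹ * r) < EMetric.diam (univ : Set X) := by
      rw [ENNReal.ofReal_mul (by norm_num), ENNReal.ofReal_inv_of_pos (by norm_num)]
      rw [mul_comm, ← div_eq_mul_inv]
      apply ENNReal.div_lt_of_lt_mul'
      simpa using h
    calc ENNReal.ofReal (C⁻¹ * (8⁻¹ : ℝ) ^ Q * r ^ Q)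
        = ENNReal.ofReal (C⁻¹ * (8⁻¹ * r) ^ Q) := by
          rw [Real.mul_rpow (by norm_num) hr0.le, mul_assoc]
      _ ≤ μ (ball x (8⁻¹ * r)) := (hr x _ (by positivity) h8).1
      _ ≤ μ (ball x r) := measure_mono (ball_subset_ball (by linarith))

/-- The covering condition without restriction on the radius. -/
def CovAll (E : Set X) (s C : ℝ) : Prop :=
  ∀ x ∈ E, ∀ r R : ℝ, 0 < r → r < R →
    ∃ F : Finset X, (F.card : ℝ) ≤ C * (R / r) ^ s ∧ E ∩ ball x R ⊆ ⋃ y ∈ F, ball y r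

lemma covAll_of_mem [Nontrivial X] (E : Set X) (s : ℝ) (hs : s ∈ assouadDimBddSet E) :
    0 ≤ s ∧ ∃ C : ℝ, 1 ≤ C ∧ CovAll E s C := by
  obtain ⟨hs0, C, hC, h⟩ := hs
  refine ⟨hs0, C, hC, ?_⟩
  intro x hx r R hr hrR
  by_cases hR : ENNReal.ofReal R < 2 * EMetric.diam (univ : Set X)
  · exact h x hx r R hr hrR hR
  rw [not_lt] at hR
  have hfin : EMetric.diam (univ : Set X) ≠ ∞ := by
    intro h0
    rw [h0] at hR
    simp at hR
  have hpos : EMetric.diam (univ : Set X) ≠ 0 := by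
    obtain ⟨a, b, hab⟩ := exists_pair_ne X
    intro h0
    have : edist a b ≤ EMetric.diam (univ : Set X) :=
          Metric.edist_le_ediam_of_mem (mem_univ a) (mem_univ b)
    rw [h0] at this
    exact hab (edist_le_zero.1 this)
  set d := (EMetric.diam (univ : Set X)).toReal with hd
  have hd0 : 0 < d := ENNReal.toReal_pos hpos hfin
  have hdd : ENNReal.ofReal d = EMetric.diam (univ : Set X) := ENNReal.ofReal_toReal hfin
  have h2d : 2 * EMetric.diam (univ : Set X) = ENNReal.ofReal (2 * d) := by
    rw [ENNReal.ofReal_mul (by norm_num), hdd]; simp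
  have hdist : ∀ y z : X, dist y z ≤ d := by
    intro y z
    have h1 : edist y z ≤ ENNReal.ofReal d := by
      rw [hdd]; exact Metric.edist_le_ediam_of_mem (mem_univ y) (mem_univ z)
    rwa [edist_dist, ENNReal.ofReal_le_ofReal_iff hd0.le] at h1
  have hdR : 2 * d ≤ R := by
    rw [h2d] at hR
    exact (ENNReal.ofReal_le_ofReal_iff (by linarith)).1 hR
  by_cases hr2 : d < r
  · refine ⟨{x}, ?_, ?_⟩
    · have h1 : 1 ≤ (R / r) ^ s := Real.one_le_rpow (by rw [le_div_iff₀ hr]; linarith) hs0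
      simp
      nlinarith
    · intro y _
      simp only [Finset.mem_singleton, iUnion_iUnion_eq_left, mem_ball]
      exact (hdist y x).trans_lt hr2
  · rw [not_lt] at hr2
    obtain ⟨F, hF1, hF2⟩ := h x hx r (3 / 2 * d) hr (by linarith) (by
      rw [h2d]; exact (ENNReal.ofReal_lt_ofReal_iff (by linarith)).2 (by linarith))
    refine ⟨F, hF1.trans ?_, ?_⟩
    · gcongr
      linarith
    · intro y hy
      exact hF2 ⟨hy.1, by rw [mem_ball]; exact (hdist y x).trans_lt (by linarith)⟩

/-- Measure of tubular neighbourhoods. -/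
lemma tube_bound (μ : Measure X) (Q U : ℝ) (hU0 : 0 < U)
    (hU : ∀ (x : X) (r : ℝ), 0 < r → μ (ball x r) ≤ ENNReal.ofReal (U * r ^ Q))
    (E : Set X) (hE : E.Nonempty) (s C : ℝ) (hC : 1 ≤ C) (hcov : CovAll E s C) :
    ∃ M : ℝ, 0 < M ∧ ∀ e ∈ E, ∀ t R : ℝ, 0 < t → t ≤ R →
      μ ({y : X | infDist y E < t} ∩ ball e R) ≤
        ENNReal.ofReal (M * (t / R) ^ (Q - s) * R ^ Q) := by
  refine ⟨C * 2 ^ s * (U * 2 ^ Q), by positivity, ?_⟩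
  intro e he t R ht htR
  have hR : 0 < R := by linarith
  obtain ⟨F, hF1, hF2⟩ := hcov e he t (2 * R) ht (by linarith)
  have hsub : {y : X | infDist y E < t} ∩ ball e R ⊆ ⋃ y ∈ F, ball y (2 * t) := by
    rintro y ⟨hy1, hy2⟩
    obtain ⟨z, hz, hyz⟩ := (infDist_lt_iff hE).1 hy1
    have : z ∈ E ∩ ball e (2 * R) := by
      refine ⟨hz, ?_⟩
      rw [mem_ball] at hy2 ⊢
      have := dist_triangle z y e
      rw [dist_comm z y] at this
      linarith
    have := hF2 this
    simp only [mem_iUnion, mem_ball, exists_prop] at this ⊢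
    obtain ⟨c, hc, hzc⟩ := this
    exact ⟨c, hc, by have := dist_triangle y z c; linarith⟩
  calc μ ({y : X | infDist y E < t} ∩ ball e R) ≤ μ (⋃ y ∈ F, ball y (2 * t)) := measure_mono hsub
    _ ≤ ∑ y ∈ F, μ (ball y (2 * t)) := measure_biUnion_finset_le _ _
    _ ≤ ∑ y ∈ F, ENNReal.ofReal (U * (2 * t) ^ Q) :=
        Finset.sum_le_sum fun y _ => hU y _ (by positivity)
    _ = ENNReal.ofReal (F.card * (U * (2 * t) ^ Q)) := by
        rw [Finset.sum_const, nsmul_eq_mul, ENNReal.ofReal_mul (Nat.cast_nonneg F.card), ENNReal.ofReal_natCast]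
    _ ≤ ENNReal.ofReal ((C * (2 * R / t) ^ s) * (U * (2 * t) ^ Q)) := by
        apply ENNReal.ofReal_le_ofReal
        gcongr
    _ = _ := by
        congr 1
        rw [Real.div_rpow (by positivity) ht.le, Real.mul_rpow (by positivity) hR.le,
          Real.mul_rpow (by positivity) ht.le, Real.div_rpow ht.le hR.le,
          Real.rpow_sub ht, Real.rpow_sub hR]
        field_simp

/-- `E` has measure zero. -/
lemma measure_zero_of_tube (μ : Measure X) (Q s M : ℝ) (hs : s < Q)
    (E : Set X) (hE : E.Nonempty)
    (htube : ∀ e ∈ E, ∀ t R : ℝ, 0 < t → t ≤ R →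
      μ ({y : X | infDist y E < t} ∩ ball e R) ≤
        ENNReal.ofReal (M * (t / R) ^ (Q - s) * R ^ Q)) : μ E = 0 := by
  obtain ⟨e, he⟩ := hE
  have h1 : ∀ n : ℕ, μ (E ∩ ball e ((n : ℝ) + 1)) = 0 := by
    intro n
    set R : ℝ := (n : ℝ) + 1
    have hR : 0 < R := by positivity
    have hlim : Filter.Tendsto (fun t : ℝ => ENNReal.ofReal (M * (t / R) ^ (Q - s) * R ^ Q))
        (nhdsWithin 0 (Ioi 0)) (nhds 0) := by
      have : Filter.Tendsto (fun t : ℝ => ENNReal.ofReal (M * (t / R) ^ (Q - s) * R ^ Q))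
          (nhds 0) (nhds (ENNReal.ofReal (M * ((0:ℝ) / R) ^ (Q - s) * R ^ Q))) := by
        apply ENNReal.tendsto_ofReal
        apply Filter.Tendsto.mul_const
        apply Filter.Tendsto.const_mul
        apply Filter.Tendsto.rpow_const
        · exact Filter.Tendsto.div_const Filter.tendsto_id R
        · right; linarith
      rw [zero_div, Real.zero_rpow (by linarith)] at this
      simp only [mul_zero, zero_mul, ENNReal.ofReal_zero] at this
      exact this.mono_left nhdsWithin_le_nhds
    refine le_antisymm (ge_of_tendsto hlim ?_) zero_le
    have : Ioo (0:ℝ) R ∈ nhdsWithin (0:ℝ) (Ioi 0) := Ioo_mem_nhdsGT hR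
    filter_upwards [this] with t ht
    refine le_trans (measure_mono ?_) (htube e he t R ht.1 ht.2.le)
    rintro y ⟨hy, hy2⟩
    refine ⟨?_, hy2⟩
    simp only [mem_setOf_eq]
    rw [infDist_zero_of_mem hy]; exact ht.1
  have h2 : E ⊆ ⋃ n : ℕ, E ∩ ball e ((n : ℝ) + 1) := by
    intro y hy
    obtain ⟨n, hn⟩ := exists_nat_gt (dist y e)
    exact mem_iUnion.2 ⟨n, hy, by rw [mem_ball]; linarith⟩
  exact measure_mono_null h2 (measure_iUnion_null h1)

/-- Aikawa type estimate for balls centred in `E`. -/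
lemma aikawa_center (μ : Measure X) (Q s M a : ℝ) (hM : 0 < M) (ha : 0 ≤ a) (has : a < Q - s)
    (E : Set X) (hE : E.Nonempty) (hEc : IsClosed E)
    (htube : ∀ e ∈ E, ∀ t R : ℝ, 0 < t → t ≤ R →
      μ ({y : X | infDist y E < t} ∩ ball e R) ≤
        ENNReal.ofReal (M * (t / R) ^ (Q - s) * R ^ Q)) :
    ∃ K : ℝ, 0 < K ∧ ∀ e ∈ E, ∀ R : ℝ, 0 < R →
      ∫⁻ y in ball e R, ENNReal.ofReal (infDist y E) ^ (-a) ∂μ ≤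
        ENNReal.ofReal (K * R ^ (Q - a)) := by
  have hnull : μ E = 0 := measure_zero_of_tube μ Q s M (by linarith) E hE htube
  set q : ℝ := (2⁻¹ : ℝ) ^ (Q - s - a) with hq
  have hq0 : 0 < q := by positivity
  have hq1 : q < 1 := Real.rpow_lt_one (by norm_num) (by norm_num) (by linarith)
  have hq1' : 0 < 1 - q := by linarith
  refine ⟨2 ^ a * M * (1 - q)⁻¹, by positivity, ?_⟩
  intro e he R hR
  let t : ℕ → ℝ := fun k => 2⁻¹ ^ k * R
  have ht0 : ∀ k, 0 < t k := fun k => by positivity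
  have htR : ∀ k, t k ≤ R := fun k => by
    have : (2⁻¹ : ℝ) ^ k ≤ 1 := pow_le_one₀ (by norm_num) (by norm_num)
    simp only [t]; nlinarith
  let S : ℕ → Set X := fun k => {y : X | infDist y E < t k} ∩ ball e R
  have hS : ∀ k, MeasurableSet (S k) := fun k =>
    ((isOpen_lt (continuous_infDist_pt E) continuous_const).inter isOpen_ball).measurableSet
  have hpt : ∀ y ∈ ball e R, y ∉ E → ENNReal.ofReal (infDist y E) ^ (-a) ≤
      ∑' k, (S k).indicator (fun _ => ENNReal.ofReal (2 ^ a * t k ^ (-a))) y := by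
    intro y hy hyE
    have hpos : 0 < infDist y E := (hEc.notMem_iff_infDist_pos hE).1 hyE
    have hlt : infDist y E < R := (infDist_le_dist_of_mem he).trans_lt hy
    obtain ⟨n, hn1, hn2⟩ := exists_nat_pow_near_of_lt_one (x := infDist y E / R) (y := (2⁻¹:ℝ))
      (by positivity) (by rw [div_le_one hR]; exact hlt.le) (by norm_num) (by norm_num)
    rw [lt_div_iff₀ hR] at hn1
    rw [div_le_iff₀ hR] at hn2
    have key : ENNReal.ofReal (infDist y E) ^ (-a) ≤ ENNReal.ofReal (2 ^ a * t n ^ (-a)) := by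
      rw [ENNReal.ofReal_rpow_of_pos hpos]
      apply ENNReal.ofReal_le_ofReal
      have : (2:ℝ) ^ a * t n ^ (-a) = (2⁻¹ * t n) ^ (-a) := by
        rw [Real.mul_rpow (by norm_num) (ht0 n).le, Real.inv_rpow (by norm_num),
          Real.rpow_neg (by norm_num : (0:ℝ) ≤ 2) a, inv_inv]
      rw [this]
      apply Real.rpow_le_rpow_of_nonpos (by have := ht0 n; positivity) _ (by linarith)
      simp only [t]
      rw [pow_succ] at hn1
      linarith
    by_cases hlast : infDist y E < t n
    · refine key.trans ?_
      refine le_trans ?_ (ENNReal.le_tsum n)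
      rw [indicator_of_mem (show y ∈ S n from ⟨hlast, hy⟩)]
    · -- then infDist y E = t n, and n ≥ 1
      have heq : infDist y E = t n := le_antisymm hn2 (not_lt.1 hlast)
      cases n with
      | zero => simp [t] at heq; linarith
      | succ m =>
        have hm : infDist y E < t m := by
          rw [heq]; simp only [t]; rw [pow_succ]
          have : 0 < (2⁻¹:ℝ) ^ m * R := by positivity
          linarith
        refine le_trans ?_ (ENNReal.le_tsum m)
        rw [indicator_of_mem (show y ∈ S m from ⟨hm, hy⟩), ENNReal.ofReal_rpow_of_pos hpos]
        apply ENNReal.ofReal_le_ofReal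
        have : (2:ℝ) ^ a * t m ^ (-a) = (2⁻¹ * t m) ^ (-a) := by
          rw [Real.mul_rpow (by norm_num) (ht0 m).le, Real.inv_rpow (by norm_num),
            Real.rpow_neg (by norm_num : (0:ℝ) ≤ 2) a, inv_inv]
        rw [this, heq]
        apply le_of_eq
        congr 1
        simp only [t]
        ring
  calc ∫⁻ y in ball e R, ENNReal.ofReal (infDist y E) ^ (-a) ∂μ
      ≤ ∫⁻ y in ball e R, ∑' k, (S k).indicator
          (fun _ => ENNReal.ofReal (2 ^ a * t k ^ (-a))) y ∂μ := by
        apply lintegral_mono_ae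
        have h1 : ∀ᵐ y ∂(μ.restrict (ball e R)), y ∉ E :=
          ae_restrict_of_ae (measure_eq_zero_iff_ae_notMem.1 hnull)
        filter_upwards [h1, ae_restrict_mem measurableSet_ball] with y hy1 hy2
        exact hpt y hy2 hy1
    _ ≤ ∫⁻ y, ∑' k, (S k).indicator
          (fun _ => ENNReal.ofReal (2 ^ a * t k ^ (-a))) y ∂μ := setLIntegral_le_lintegral _ _
    _ = ∑' k, ∫⁻ y, (S k).indicator
          (fun _ => ENNReal.ofReal (2 ^ a * t k ^ (-a))) y ∂μ :=
        lintegral_tsum fun k => (measurable_const.indicator (hS k)).aemeasurable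
    _ = ∑' k, ENNReal.ofReal (2 ^ a * t k ^ (-a)) * μ (S k) := by
        congr 1; ext k; rw [lintegral_indicator_const (hS k)]
    _ ≤ ∑' k, ENNReal.ofReal (2 ^ a * M * R ^ (Q - a) * q ^ k) := by
        apply ENNReal.tsum_le_tsum
        intro k
        have := htube e he (t k) R (ht0 k) (htR k)
        refine (mul_le_mul_right this _).trans ?_
        rw [← ENNReal.ofReal_mul (by have := ht0 k; positivity)]
        apply ENNReal.ofReal_le_ofReal
        apply le_of_eq
        have e1 : t k / R = 2⁻¹ ^ k := by simp only [t]; field_simp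
        have e2 : (2⁻¹ ^ k : ℝ) ^ (Q - s) * ((2⁻¹ ^ k : ℝ) ^ (-a)) = q ^ k := by
          rw [← Real.rpow_add (by positivity), hq, ← Real.rpow_natCast, ← Real.rpow_natCast,
            ← Real.rpow_mul (by norm_num), ← Real.rpow_mul (by norm_num)]
          congr 1; ring
        rw [e1]
        simp only [t]
        rw [Real.mul_rpow (by positivity) hR.le, ← e2, sub_eq_add_neg Q a, Real.rpow_add hR]
        ring
    _ = ENNReal.ofReal (∑' k, 2 ^ a * M * R ^ (Q - a) * q ^ k) := by
        rw [ENNReal.ofReal_tsum_of_nonneg (fun k => by positivity)]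
        exact (summable_geometric_of_lt_one hq0.le hq1).mul_left _
    _ = _ := by
        rw [tsum_mul_left, tsum_geometric_of_lt_one hq0.le hq1]
        congr 1; ring

/-- Average estimate for arbitrary balls. -/
lemma avg_bound (μ : Measure X) (Q s M a L : ℝ) (hM : 0 < M) (has : a < Q - s) (hL0 : 0 < L)
    (hL : ∀ (x : X) (r : ℝ), 0 < r → ENNReal.ofReal r < 8 * EMetric.diam (univ : Set X) →
        ENNReal.ofReal (L * r ^ Q) ≤ μ (ball x r))
    (E : Set X) (hE : E.Nonempty) (hEc : IsClosed E)
    (htube : ∀ e ∈ E, ∀ t R : ℝ, 0 < t → t ≤ R →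
      μ ({y : X | infDist y E < t} ∩ ball e R) ≤
        ENNReal.ofReal (M * (t / R) ^ (Q - s) * R ^ Q)) :
    ∃ K : ℝ, 0 < K ∧ ∀ (x : X) (r : ℝ), 0 < r →
      ENNReal.ofReal r < 8 * EMetric.diam (univ : Set X) →
      ∫⁻ y in ball x r, ENNReal.ofReal (infDist y E) ^ (-a) ∂μ ≤
        ENNReal.ofReal (K * (infDist x E + r) ^ (-a)) * μ (ball x r) := by
  rcases lt_or_ge a 0 with ha | ha
  · refine ⟨1, one_pos, fun x r hr _ => ?_⟩
    rw [← setLIntegral_const]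
    apply setLIntegral_mono' measurableSet_ball
    intro y hy
    have h1 : infDist y E ≤ infDist x E + r := by
      have := infDist_le_infDist_add_dist (s := E) (x := y) (y := x)
      rw [mem_ball] at hy
      linarith
    rw [one_mul, ← ENNReal.ofReal_rpow_of_pos (by have := infDist_nonneg (x := x) (s := E); linarith)]
    exact ENNReal.rpow_le_rpow (ENNReal.ofReal_le_ofReal h1) (by linarith)
  · obtain ⟨K, hK, hint⟩ := aikawa_center μ Q s M a hM ha has E hE hEc htube
    refine ⟨3 ^ a + K * 3 ^ (Q - a) * 3 ^ a * L⁻¹, by positivity, fun x r hr hr8 => ?_⟩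
    have hd0 := infDist_nonneg (x := x) (s := E)
    have hP : 0 < (infDist x E + r) ^ (-a) := Real.rpow_pos_of_pos (by linarith) _
    have h3 : (3⁻¹ * (infDist x E + r)) ^ (-a) = 3 ^ a * (infDist x E + r) ^ (-a) := by
      rw [Real.mul_rpow (by norm_num) (by linarith), Real.inv_rpow (by norm_num),
          Real.rpow_neg (by norm_num : (0:ℝ) ≤ 3) a, inv_inv]
    rcases le_or_gt (2 * r) (infDist x E) with h | h
    · rw [← setLIntegral_const]
      apply setLIntegral_mono' measurableSet_ball
      intro y hy
      have h1 : 3⁻¹ * (infDist x E + r) ≤ infDist y E := by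
        have := infDist_le_infDist_add_dist (s := E) (x := x) (y := y)
        rw [mem_ball, dist_comm] at hy
        linarith
      rw [ENNReal.ofReal_rpow_of_pos (by linarith)]
      apply ENNReal.ofReal_le_ofReal
      calc infDist y E ^ (-a) ≤ (3⁻¹ * (infDist x E + r)) ^ (-a) :=
            Real.rpow_le_rpow_of_nonpos (by linarith) h1 (by linarith)
        _ = 3 ^ a * (infDist x E + r) ^ (-a) := h3
        _ ≤ _ := by
            have : 0 < K * 3 ^ (Q - a) * 3 ^ a * L⁻¹ := by positivity
            gcongr
            linarith
    · obtain ⟨e, he, hxe⟩ := (infDist_lt_iff hE).1 h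
      have hsub : ball x r ⊆ ball e (3 * r) := ball_subset_ball' (by linarith)
      calc ∫⁻ y in ball x r, ENNReal.ofReal (infDist y E) ^ (-a) ∂μ
          ≤ ∫⁻ y in ball e (3 * r), ENNReal.ofReal (infDist y E) ^ (-a) ∂μ :=
            lintegral_mono_set hsub
        _ ≤ ENNReal.ofReal (K * (3 * r) ^ (Q - a)) := hint e he _ (by positivity)
        _ ≤ ENNReal.ofReal ((3 ^ a + K * 3 ^ (Q - a) * 3 ^ a * L⁻¹) *
              (infDist x E + r) ^ (-a) * (L * r ^ Q)) := by
            apply ENNReal.ofReal_le_ofReal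
            have h4 : r ^ (-a) ≤ (3⁻¹ * (infDist x E + r)) ^ (-a) :=
              Real.rpow_le_rpow_of_nonpos (by linarith) (by linarith) (by linarith)
            rw [h3] at h4
            calc K * (3 * r) ^ (Q - a) = K * 3 ^ (Q - a) * L⁻¹ * r ^ (-a) * (L * r ^ Q) := by
                  rw [Real.mul_rpow (by norm_num) hr.le, sub_eq_add_neg Q a, Real.rpow_add hr]
                  field_simp
              _ ≤ K * 3 ^ (Q - a) * L⁻¹ * (3 ^ a * (infDist x E + r) ^ (-a)) * (L * r ^ Q) := by
                  gcongr
              _ = (K * 3 ^ (Q - a) * 3 ^ a * L⁻¹) * (infDist x E + r) ^ (-a) * (L * r ^ Q) := by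
                  ring
              _ ≤ _ := by
                  gcongr
                  have : (0:ℝ) < 3 ^ a := by positivity
                  linarith
        _ = ENNReal.ofReal ((3 ^ a + K * 3 ^ (Q - a) * 3 ^ a * L⁻¹) *
              (infDist x E + r) ^ (-a)) * ENNReal.ofReal (L * r ^ Q) :=
            ENNReal.ofReal_mul (by positivity)
        _ ≤ _ := by
            gcongr
            exact hL x r hr hr8

/-- A maximal separated set and its cardinality bound. -/
lemma exists_packing (μ : Measure X) (Q L : ℝ) (hL0 : 0 < L)
    (hL : ∀ (x : X) (r : ℝ), 0 < r → ENNReal.ofReal r < 8 * EMetric.diam (univ : Set X) →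
        ENNReal.ofReal (L * r ^ Q) ≤ μ (ball x r))
    (E : Set X) (x : X) (t R : ℝ) (ht : 0 < t) (htR : t ≤ R)
    (ht8 : ENNReal.ofReal t < 8 * EMetric.diam (univ : Set X))
    (hfin : μ (ball x (2 * R)) ≠ ∞) :
    ∃ F : Finset X, (F : Set X) ⊆ E ∧ E ∩ ball x R ⊆ ⋃ y ∈ F, ball y t ∧
      (F.card : ℝ≥0∞) * ENNReal.ofReal (L * (t / 2) ^ Q) ≤
        μ ({y : X | infDist y E < t} ∩ ball x (2 * R)) := by
  classical
  set m : ℝ≥0∞ := ENNReal.ofReal (L * (t / 2) ^ Q) with hm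
  have hm0 : m ≠ 0 := by
    have : 0 < L * (t / 2) ^ Q := by positivity
    rw [hm]
    simpa using this
  have hmt : m ≠ ∞ := ENNReal.ofReal_ne_top
  let P : Finset X → Prop := fun F => (F : Set X) ⊆ E ∩ ball x R ∧
    ∀ y ∈ F, ∀ z ∈ F, y ≠ z → t ≤ dist y z
  set V := μ ({y : X | infDist y E < t} ∩ ball x (2 * R)) with hV
  have hVt : V ≠ ∞ := ne_top_of_le_ne_top hfin (measure_mono inter_subset_right)
  have hcard : ∀ F, P F → (F.card : ℝ≥0∞) * m ≤ V := by
    intro F hF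
    have hdisj : Set.PairwiseDisjoint (F : Set X) (fun y => ball y (t / 2)) := by
      intro y hy z hz hyz
      exact ball_disjoint_ball (by have := hF.2 y hy z hz hyz; linarith)
    calc (F.card : ℝ≥0∞) * m = ∑ y ∈ F, m := by rw [Finset.sum_const, nsmul_eq_mul]
      _ ≤ ∑ y ∈ F, μ (ball y (t / 2)) := by
          apply Finset.sum_le_sum
          intro y _
          exact hL y _ (by positivity)
            ((ENNReal.ofReal_le_ofReal (by linarith)).trans_lt ht8)
      _ = μ (⋃ y ∈ F, ball y (t / 2)) :=
          (measure_biUnion_finset hdisj fun y _ => measurableSet_ball).symm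
      _ ≤ V := by
          apply measure_mono
          intro z hz
          simp only [mem_iUnion, exists_prop] at hz
          obtain ⟨y, hy, hzy⟩ := hz
          have hyE := hF.1 hy
          rw [mem_ball] at hzy
          refine ⟨?_, ?_⟩
          · exact (infDist_le_dist_of_mem hyE.1).trans_lt (by linarith)
          · have h1 := hyE.2
            rw [mem_ball] at h1 ⊢
            have := dist_triangle z y x
            linarith
  let N : Set ℕ := {n | ∃ F, P F ∧ F.card = n}
  have hNne : N.Nonempty := ⟨0, ∅, ⟨by simp, by simp⟩, rfl⟩
  have hNb : BddAbove N := by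
    obtain ⟨n, hn⟩ := ENNReal.exists_nat_gt (ENNReal.div_ne_top hVt hm0)
    refine ⟨n, ?_⟩
    rintro k ⟨F, hF, rfl⟩
    have h1 : (F.card : ℝ≥0∞) ≤ V / m := by
      rw [ENNReal.le_div_iff_mul_le (Or.inl hm0) (Or.inl hmt)]
      exact hcard F hF
    exact_mod_cast (h1.trans_lt hn).le
  obtain ⟨F, hF, hFc⟩ := Nat.sSup_mem hNne hNb
  refine ⟨F, hF.1.trans inter_subset_left, ?_, hcard F hF⟩
  intro z hz
  by_contra hcon
  simp only [mem_iUnion, exists_prop, not_exists, not_and, mem_ball, not_lt] at hcon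
  have hzF : z ∉ F := by
    intro h
    have := hcon z h
    rw [dist_self] at this
    linarith
  have hP : P (insert z F) := by
    refine ⟨?_, ?_⟩
    · rw [Finset.coe_insert]
      exact insert_subset hz hF.1
    · intro y hy w hw hyw
      rw [Finset.mem_insert] at hy hw
      rcases hy with rfl | hy <;> rcases hw with rfl | hw
      · exact absurd rfl hyw
      · exact hcon w hw
      · rw [dist_comm]; exact hcon y hy
      · exact hF.2 y hy w hw hyw
  have hle : (insert z F).card ≤ sSup N := le_csSup hNb ⟨_, hP, rfl⟩
  rw [Finset.card_insert_of_notMem hzF] at hle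
  omega

lemma mem_assouadDimBddSet_Q (μ : Measure X) (Q U L : ℝ) (hQ : 0 < Q) (hU0 : 0 < U) (hL0 : 0 < L)
    (hU : ∀ (x : X) (r : ℝ), 0 < r → μ (ball x r) ≤ ENNReal.ofReal (U * r ^ Q))
    (hL : ∀ (x : X) (r : ℝ), 0 < r → ENNReal.ofReal r < 8 * EMetric.diam (univ : Set X) →
        ENNReal.ofReal (L * r ^ Q) ≤ μ (ball x r))
    (E : Set X) : Q ∈ assouadDimBddSet E := by
  refine ⟨hQ.le, 1 + U * 4 ^ Q / L, ?_, ?_⟩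
  · have : 0 < U * 4 ^ Q / L := by positivity
    linarith
  intro x hx r R hr hrR hR
  have hR0 : 0 < R := hr.trans hrR
  have hr8 : ENNReal.ofReal r < 8 * EMetric.diam (univ : Set X) := by
    calc ENNReal.ofReal r ≤ ENNReal.ofReal R := ENNReal.ofReal_le_ofReal hrR.le
      _ < 2 * EMetric.diam (univ : Set X) := hR
      _ ≤ _ := by gcongr; norm_num
  obtain ⟨F, -, hF2, hF3⟩ := exists_packing μ Q L hL0 hL E x r R hr hrR.le hr8
    (ne_top_of_le_ne_top ENNReal.ofReal_ne_top (hU x _ (by positivity)))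
  refine ⟨F, ?_, hF2⟩
  have h1 : ENNReal.ofReal (F.card * (L * (r / 2) ^ Q)) ≤ ENNReal.ofReal (U * (2 * R) ^ Q) := by
    rw [ENNReal.ofReal_mul (Nat.cast_nonneg F.card), ENNReal.ofReal_natCast]
    exact hF3.trans ((measure_mono inter_subset_right).trans (hU x _ (by positivity)))
  rw [ENNReal.ofReal_le_ofReal_iff (by positivity)] at h1
  have h2 : U * (2 * R) ^ Q = (U * 4 ^ Q / L * (R / r) ^ Q) * (L * (r / 2) ^ Q) := by
    have : (2 * R) = 4 * (R / r) * (r / 2) := by field_simp; norm_num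
    rw [this, Real.mul_rpow (by positivity) (by positivity),
      Real.mul_rpow (by positivity) (by positivity)]
    field_simp
  rw [h2] at h1
  have h3 := le_of_mul_le_mul_right h1 (by positivity)
  have h4 : 0 < (R / r) ^ Q := by positivity
  nlinarith

lemma geom_sum_bound (β R u : ℝ) (hβ : 0 < β) (hR : 0 < R) (hu : 0 < u) (n : ℕ) :
    ∑ k ∈ Finset.range n, (if u < 2⁻¹ ^ (k + 1) * R then (2⁻¹ ^ (k + 1) * R) ^ (-β) else 0) ≤
      (1 - (2⁻¹ : ℝ) ^ β)⁻¹ * min ((2⁻¹ ^ n * R) ^ (-β)) (u ^ (-β)) := by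
  set q : ℝ := (2⁻¹ : ℝ) ^ β with hq
  have hq0 : 0 < q := by positivity
  have hq1 : q < 1 := Real.rpow_lt_one (by norm_num) (by norm_num) hβ
  have hG : 0 < (1 - q)⁻¹ := inv_pos.2 (by linarith)
  induction n with
  | zero => simp; positivity
  | succ n ih =>
    rw [Finset.sum_range_succ]
    have hstep : (2⁻¹ ^ n * R) ^ (-β) = q * (2⁻¹ ^ (n + 1) * R) ^ (-β) := by
      have : (2⁻¹ ^ (n + 1) * R) = 2⁻¹ * (2⁻¹ ^ n * R) := by ring
      have h2 : (2⁻¹ * (2⁻¹ ^ n * R)) ^ (-β) = (2⁻¹ : ℝ) ^ (-β) * (2⁻¹ ^ n * R) ^ (-β) :=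
        Real.mul_rpow (by norm_num) (by positivity)
      have h3 : (2⁻¹ : ℝ) ^ β * (2⁻¹ : ℝ) ^ (-β) = 1 := by
        rw [← Real.rpow_add (by norm_num), add_neg_cancel, Real.rpow_zero]
      rw [this, h2, hq, ← mul_assoc, h3, one_mul]
    set T := (2⁻¹ ^ (n + 1) * R) ^ (-β) with hT
    have hT0 : 0 < T := by positivity
    split_ifs with h
    · have h1 : T ≤ u ^ (-β) := Real.rpow_le_rpow_of_nonpos hu h.le (by linarith)
      rw [min_eq_left h1]
      have h2 : (1 - q)⁻¹ * min ((2⁻¹ ^ n * R) ^ (-β)) (u ^ (-β)) ≤ (1 - q)⁻¹ * (q * T) := by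
        rw [← hstep]; gcongr; exact min_le_left _ _
      have h3 : (1 - q)⁻¹ * (q * T) + T = (1 - q)⁻¹ * T := by
        have : 1 - q ≠ 0 := by linarith
        field_simp; ring
      linarith
    · rw [add_zero]
      refine ih.trans ?_
      gcongr
      rw [hstep]
      nlinarith

/-- One step of the covering argument. -/
lemma exists_good_scale (μ : Measure X) (Q U L C β : ℝ) (hβ : 0 < β) (hL0 : 0 < L) (hC : 0 < C)
    (hU : ∀ (x : X) (r : ℝ), 0 < r → μ (ball x r) ≤ ENNReal.ofReal (U * r ^ Q))
    (hL : ∀ (x : X) (r : ℝ), 0 < r → ENNReal.ofReal r < 8 * EMetric.diam (univ : Set X) →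
        ENNReal.ofReal (L * r ^ Q) ≤ μ (ball x r))
    (E : Set X)
    (hA : ∀ x ∈ E, ∀ R : ℝ, 0 < R → ENNReal.ofReal R < 4 * EMetric.diam (univ : Set X) →
      ∫⁻ y in ball x R, ENNReal.ofReal (infDist y E) ^ (-β) ∂μ ≤ ENNReal.ofReal (C * R ^ (Q - β))) :
    ∃ K : ℕ, 0 < K ∧ ∀ x ∈ E, ∀ R : ℝ, 0 < R →
      ENNReal.ofReal R < 2 * EMetric.diam (univ : Set X) →
      ∃ k : ℕ, 0 < k ∧ k ≤ K ∧ ∃ F : Finset X, (F : Set X) ⊆ E ∧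
        E ∩ ball x R ⊆ ⋃ y ∈ F, ball y (2⁻¹ ^ k * R) ∧
        (F.card : ℝ) * (2⁻¹ ^ k : ℝ) ^ (Q - β) ≤ 1 / 2 := by
  set q : ℝ := (2⁻¹ : ℝ) ^ β with hq
  have hq1 : q < 1 := Real.rpow_lt_one (by norm_num) (by norm_num) hβ
  set G := (1 - q)⁻¹ with hGdef
  have hG : 0 < G := inv_pos.2 (by linarith)
  obtain ⟨K, hK⟩ := exists_nat_gt (G * (C * 2 ^ (Q - β)) * (2 * 2 ^ Q / L))
  have hK0 : 0 < K := by
    have : (0:ℝ) < K := lt_trans (by positivity) hK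
    exact_mod_cast this
  refine ⟨K, hK0, ?_⟩
  intro x hx R hR hRd
  by_contra hcon
  push Not at hcon
  let t : ℕ → ℝ := fun k => 2⁻¹ ^ (k + 1) * R
  have ht0 : ∀ k, 0 < t k := fun k => by positivity
  have htR : ∀ k, t k ≤ R := fun k => by
    have : (2⁻¹ : ℝ) ^ (k + 1) ≤ 1 := pow_le_one₀ (by norm_num) (by norm_num)
    simp only [t]; nlinarith
  let S : ℕ → Set X := fun k => {y : X | infDist y E < t k} ∩ ball x (2 * R)
  have hS : ∀ k, MeasurableSet (S k) := fun k =>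
    ((isOpen_lt (continuous_infDist_pt E) continuous_const).inter isOpen_ball).measurableSet
  have hlow : ∀ k ∈ Finset.range K,
      ENNReal.ofReal (L / (2 * 2 ^ Q) * R ^ (Q - β)) ≤ ENNReal.ofReal (t k ^ (-β)) * μ (S k) := by
    intro k hk
    rw [Finset.mem_range] at hk
    have ht8 : ENNReal.ofReal (t k) < 8 * EMetric.diam (univ : Set X) := by
      calc ENNReal.ofReal (t k) ≤ ENNReal.ofReal R := ENNReal.ofReal_le_ofReal (htR k)
        _ < 2 * EMetric.diam (univ : Set X) := hRd
        _ ≤ _ := by gcongr; norm_num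
    obtain ⟨F, hF1, hF2, hF3⟩ := exists_packing μ Q L hL0 hL E x (t k) R (ht0 k) (htR k) ht8
      (ne_top_of_le_ne_top ENNReal.ofReal_ne_top (hU x _ (by positivity)))
    have h1 := hcon (k + 1) (by omega) (by omega) F hF1 hF2
    refine le_trans ?_ (mul_le_mul_right hF3 _)
    have htk := ht0 k
    rw [← ENNReal.ofReal_natCast, ← ENNReal.ofReal_mul (Nat.cast_nonneg F.card),
      ← ENNReal.ofReal_mul (by positivity)]
    apply ENNReal.ofReal_le_ofReal
    have h2 : t k ^ (-β) * (F.card * (L * (t k / 2) ^ Q)) =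
        (F.card * (2⁻¹ ^ (k + 1) : ℝ) ^ (Q - β)) * (L / 2 ^ Q * R ^ (Q - β)) := by
      have e1 : t k ^ (Q - β) = (2⁻¹ ^ (k + 1) : ℝ) ^ (Q - β) * R ^ (Q - β) := by
        simp only [t]
        exact Real.mul_rpow (by positivity) hR.le
      have e2 : t k ^ (Q - β) = t k ^ Q * t k ^ (-β) := by
        rw [sub_eq_add_neg, Real.rpow_add htk]
      rw [Real.div_rpow htk.le (by norm_num)]
      calc _ = (t k ^ Q * t k ^ (-β)) * (F.card * (L / 2 ^ Q)) := by ring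
        _ = _ := by rw [← e2, e1]; ring
    rw [h2]
    calc L / (2 * 2 ^ Q) * R ^ (Q - β) = 1 / 2 * (L / 2 ^ Q * R ^ (Q - β)) := by
          field_simp
      _ ≤ _ := by gcongr
  have hpt : ∀ y ∈ ball x (2 * R),
      ∑ k ∈ Finset.range K, (S k).indicator (fun _ => ENNReal.ofReal (t k ^ (-β))) y ≤
        ENNReal.ofReal G * ENNReal.ofReal (infDist y E) ^ (-β) := by
    intro y hy
    rcases (infDist_nonneg (x := y) (s := E)).eq_or_lt with h0 | h0
    · rw [← h0]
      simp only [ENNReal.ofReal_zero]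
      rw [ENNReal.zero_rpow_of_neg (by linarith), ENNReal.mul_top (by simpa using hG)]
      exact le_top
    · have h1 := geom_sum_bound β R (infDist y E) hβ hR h0 K
      rw [ENNReal.ofReal_rpow_of_pos h0, ← ENNReal.ofReal_mul hG.le]
      have h2 : ∀ k ∈ Finset.range K,
          (S k).indicator (fun _ => ENNReal.ofReal (t k ^ (-β))) y =
          ENNReal.ofReal (if infDist y E < 2⁻¹ ^ (k + 1) * R then (2⁻¹ ^ (k + 1) * R) ^ (-β)
            else 0) := by
        intro k _
        split_ifs with h
        · rw [indicator_of_mem (show y ∈ S k from ⟨h, hy⟩)]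
        · rw [indicator_of_notMem (fun hh : y ∈ S k => h hh.1), ENNReal.ofReal_zero]
      rw [Finset.sum_congr rfl h2, ← ENNReal.ofReal_sum_of_nonneg]
      · apply ENNReal.ofReal_le_ofReal
        refine h1.trans ?_
        gcongr
        exact min_le_right _ _
      · intro k _
        split_ifs <;> positivity
  have hR4 : ENNReal.ofReal (2 * R) < 4 * EMetric.diam (univ : Set X) := by
    rw [ENNReal.ofReal_mul (by norm_num)]
    have : (4 : ℝ≥0∞) * EMetric.diam (univ : Set X) =
        ENNReal.ofReal 2 * (2 * EMetric.diam (univ : Set X)) := by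
      rw [← mul_assoc]; congr 1; simp; norm_num
    rw [this]
    exact (ENNReal.mul_lt_mul_iff_right (by simp) (by simp)).2 hRd
  have hmain : ENNReal.ofReal (K * (L / (2 * 2 ^ Q) * R ^ (Q - β))) ≤
      ENNReal.ofReal (G * (C * (2 * R) ^ (Q - β))) := by
    calc ENNReal.ofReal (K * (L / (2 * 2 ^ Q) * R ^ (Q - β)))
        = ∑ k ∈ Finset.range K, ENNReal.ofReal (L / (2 * 2 ^ Q) * R ^ (Q - β)) := by
          rw [Finset.sum_const, Finset.card_range, nsmul_eq_mul,
            ENNReal.ofReal_mul (Nat.cast_nonneg K), ENNReal.ofReal_natCast]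
      _ ≤ ∑ k ∈ Finset.range K, ENNReal.ofReal (t k ^ (-β)) * μ (S k) := Finset.sum_le_sum hlow
      _ = ∑ k ∈ Finset.range K, ∫⁻ y in ball x (2 * R),
            (S k).indicator (fun _ => ENNReal.ofReal (t k ^ (-β))) y ∂μ := by
          apply Finset.sum_congr rfl
          intro k _
          rw [lintegral_indicator_const (hS k), Measure.restrict_apply (hS k),
            inter_eq_left.2 inter_subset_right]
      _ = ∫⁻ y in ball x (2 * R), ∑ k ∈ Finset.range K,
            (S k).indicator (fun _ => ENNReal.ofReal (t k ^ (-β))) y ∂μ :=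
          (lintegral_finsetSum _ fun k _ => measurable_const.indicator (hS k)).symm
      _ ≤ ∫⁻ y in ball x (2 * R), ENNReal.ofReal G * ENNReal.ofReal (infDist y E) ^ (-β) ∂μ :=
          setLIntegral_mono' measurableSet_ball hpt
      _ = ENNReal.ofReal G * ∫⁻ y in ball x (2 * R), ENNReal.ofReal (infDist y E) ^ (-β) ∂μ :=
          lintegral_const_mul' _ _ ENNReal.ofReal_ne_top
      _ ≤ ENNReal.ofReal G * ENNReal.ofReal (C * (2 * R) ^ (Q - β)) := by
          gcongr
          exact hA x hx _ (by positivity) hR4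
      _ = _ := (ENNReal.ofReal_mul hG.le).symm
  rw [ENNReal.ofReal_le_ofReal_iff (by positivity), Real.mul_rpow (by norm_num) hR.le] at hmain
  have hRQ : 0 < R ^ (Q - β) := by positivity
  have h5 : (K * (L / (2 * 2 ^ Q))) * R ^ (Q - β) ≤ (G * (C * 2 ^ (Q - β))) * R ^ (Q - β) := by
    linarith
  have h6 := le_of_mul_le_mul_right h5 hRQ
  have h7 : (G * (C * 2 ^ (Q - β)) * (2 * 2 ^ Q / L)) * (L / (2 * 2 ^ Q)) =
      G * (C * 2 ^ (Q - β)) := by field_simp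
  have h8 : 0 < L / (2 * 2 ^ Q) := by positivity
  nlinarith

/-- Self-improvement of the Aikawa condition. -/
lemma exists_lt_of_aikawa [Nontrivial X] (μ : Measure X) (Q U L C β : ℝ) (hβ : 0 < β)
    (hL0 : 0 < L) (hC : 0 < C)
    (hU : ∀ (x : X) (r : ℝ), 0 < r → μ (ball x r) ≤ ENNReal.ofReal (U * r ^ Q))
    (hL : ∀ (x : X) (r : ℝ), 0 < r → ENNReal.ofReal r < 8 * EMetric.diam (univ : Set X) →
        ENNReal.ofReal (L * r ^ Q) ≤ μ (ball x r))
    (E : Set X) (hE : E.Nonempty)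
    (hA : ∀ x ∈ E, ∀ R : ℝ, 0 < R → ENNReal.ofReal R < 4 * EMetric.diam (univ : Set X) →
      ∫⁻ y in ball x R, ENNReal.ofReal (infDist y E) ^ (-β) ∂μ ≤ ENNReal.ofReal (C * R ^ (Q - β))) :
    ∃ s ∈ assouadDimBddSet E, s < Q - β := by
  classical
  obtain ⟨K, hK0, hK⟩ := exists_good_scale μ Q U L C β hβ hL0 hC hU hL E hA
  have hKr : (0:ℝ) < K := by exact_mod_cast hK0
  -- positivity of the exponent
  have hpos : 0 < Q - β := by
    by_contra hneg
    rw [not_lt] at hneg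
    obtain ⟨e, he⟩ := hE
    obtain ⟨a, b, hab⟩ := exists_pair_ne X
    have hd : 0 < dist a b := dist_pos.2 hab
    have h1 : ENNReal.ofReal (dist a b) ≤ EMetric.diam (univ : Set X) := by
      rw [← edist_dist]; exact Metric.edist_le_ediam_of_mem (mem_univ a) (mem_univ b)
    have h2 : ENNReal.ofReal (dist a b) < 2 * EMetric.diam (univ : Set X) := by
      calc ENNReal.ofReal (dist a b) < ENNReal.ofReal (2 * dist a b) :=
            (ENNReal.ofReal_lt_ofReal_iff (by linarith)).2 (by linarith)
        _ = 2 * ENNReal.ofReal (dist a b) := by rw [ENNReal.ofReal_mul (by norm_num)]; simp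
        _ ≤ _ := by gcongr
    obtain ⟨k, hk0, hk, F, -, hF2, hF3⟩ := hK e he _ hd h2
    have h3 : (1:ℝ) ≤ (2⁻¹ ^ k : ℝ) ^ (Q - β) :=
      Real.one_le_rpow_of_pos_of_le_one_of_nonpos (by positivity)
        (pow_le_one₀ (by norm_num) (by norm_num)) hneg
    have h4 : (1:ℝ) ≤ F.card := by
      have := hF2 ⟨he, mem_ball_self hd⟩
      simp only [mem_iUnion, exists_prop] at this
      obtain ⟨y, hy, -⟩ := this
      have : 0 < F.card := Finset.card_pos.2 ⟨y, hy⟩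
      exact_mod_cast this
    nlinarith
  set s := max 0 (Q - β - 1 / K) with hs
  have hs0 : 0 ≤ s := le_max_left _ _
  have hslt : s < Q - β := by
    rw [hs, max_lt_iff]
    refine ⟨hpos, ?_⟩
    have : (0:ℝ) < 1 / K := by positivity
    linarith
  have hs1 : Q - β - s ≤ 1 / K := by
    have := le_max_right 0 (Q - β - 1 / K)
    rw [← hs] at this
    linarith
  refine ⟨s, ⟨hs0, 2 ^ (K * s), Real.one_le_rpow (by norm_num) (by positivity), ?_⟩, hslt⟩
  -- improved scale selection
  have hK' : ∀ x ∈ E, ∀ R : ℝ, 0 < R → ENNReal.ofReal R < 2 * EMetric.diam (univ : Set X) →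
      ∃ k : ℕ, 0 < k ∧ k ≤ K ∧ ∃ F : Finset X, (F : Set X) ⊆ E ∧
        E ∩ ball x R ⊆ ⋃ y ∈ F, ball y (2⁻¹ ^ k * R) ∧
        (F.card : ℝ) * (2⁻¹ ^ k : ℝ) ^ s ≤ 1 := by
    intro x hx R hR hRd
    obtain ⟨k, hk0, hk, F, hF1, hF2, hF3⟩ := hK x hx R hR hRd
    refine ⟨k, hk0, hk, F, hF1, hF2, ?_⟩
    have h1 : (2⁻¹ ^ k : ℝ) ^ s ≤ (2⁻¹ ^ k : ℝ) ^ (Q - β) * 2 := by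
      have e1 : (2⁻¹ ^ k : ℝ) ^ s = (2⁻¹ ^ k : ℝ) ^ (Q - β) * (2⁻¹ ^ k : ℝ) ^ (-(Q - β - s)) := by
        rw [← Real.rpow_add (by positivity)]; congr 1; ring
      have e2 : (2⁻¹ ^ k : ℝ) ^ (-(Q - β - s)) = 2 ^ (k * (Q - β - s)) := by
        rw [Real.rpow_neg (by positivity), ← Real.inv_rpow (by positivity), inv_pow, inv_inv,
          ← Real.rpow_natCast, ← Real.rpow_mul (by norm_num)]
      have e3 : (2:ℝ) ^ (k * (Q - β - s)) ≤ 2 ^ (1:ℝ) := by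
        apply Real.rpow_le_rpow_of_exponent_le (by norm_num)
        have : (k:ℝ) ≤ K := by exact_mod_cast hk
        calc (k:ℝ) * (Q - β - s) ≤ K * (1 / K) := by
              apply mul_le_mul this hs1 (by linarith) hKr.le
          _ = 1 := by field_simp
      rw [Real.rpow_one] at e3
      rw [e1, e2]
      gcongr
    calc (F.card : ℝ) * (2⁻¹ ^ k : ℝ) ^ s ≤ F.card * ((2⁻¹ ^ k : ℝ) ^ (Q - β) * 2) := by gcongr
      _ = (F.card * (2⁻¹ ^ k : ℝ) ^ (Q - β)) * 2 := by ring
      _ ≤ 1 := by linarith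
  have hind : ∀ n : ℕ, ∀ x ∈ E, ∀ r R : ℝ, 0 < r → 2⁻¹ ^ K * r ≤ R → R ≤ 2 ^ n * r →
      ENNReal.ofReal R < 2 * EMetric.diam (univ : Set X) →
      ∃ F : Finset X, (F.card : ℝ) ≤ 2 ^ (K * s) * (R / r) ^ s ∧
        E ∩ ball x R ⊆ ⋃ y ∈ F, ball y r := by
    intro n
    induction n with
    | zero =>
      intro x hx r R hr hR1 hR2 _
      refine ⟨{x}, ?_, ?_⟩
      · have h1 : (2⁻¹ ^ K : ℝ) ≤ R / r := by rw [le_div_iff₀ hr]; exact hR1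
        have h2 : (2⁻¹ ^ K : ℝ) ^ s ≤ (R / r) ^ s := Real.rpow_le_rpow (by positivity) h1 hs0
        have h3 : (2:ℝ) ^ (K * s) * (2⁻¹ ^ K : ℝ) ^ s = 1 := by
          rw [Real.rpow_mul (by norm_num), ← Real.mul_rpow (by positivity) (by positivity),
            Real.rpow_natCast, ← mul_pow]
          norm_num
        have h4 : (0:ℝ) < 2 ^ (K * s) := by positivity
        simp only [Finset.card_singleton, Nat.cast_one]
        rw [← h3]
        gcongr
      · intro y hy
        simp only [Finset.mem_singleton, iUnion_iUnion_eq_left]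
        exact ball_subset_ball (by simpa using hR2) hy.2
    | succ n ih =>
      intro x hx r R hr hR1 hR2 hRd
      by_cases hRr : R ≤ 2 ^ n * r
      · exact ih x hx r R hr hR1 hRr hRd
      rw [not_le] at hRr
      have hrR : r < R := by
        have : (1:ℝ) ≤ 2 ^ n := one_le_pow₀ (by norm_num)
        nlinarith
      have hR0 : 0 < R := hr.trans hrR
      obtain ⟨k, hk0, hk, F, hF1, hF2, hF3⟩ := hK' x hx R hR0 hRd
      have hle1 : 2⁻¹ ^ K * r ≤ 2⁻¹ ^ k * R := by
        have : (2⁻¹ : ℝ) ^ K ≤ 2⁻¹ ^ k := pow_le_pow_of_le_one (by norm_num) (by norm_num) hk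
        gcongr
      have hhalf : (2⁻¹ : ℝ) ^ k ≤ 2⁻¹ := by
        calc (2⁻¹ : ℝ) ^ k ≤ 2⁻¹ ^ 1 := pow_le_pow_of_le_one (by norm_num) (by norm_num) hk0
          _ = 2⁻¹ := pow_one _
      have hle2 : 2⁻¹ ^ k * R ≤ 2 ^ n * r := by
        rw [pow_succ] at hR2
        nlinarith
      have hle3 : 2⁻¹ ^ k * R ≤ R := by nlinarith
      have hd : ENNReal.ofReal (2⁻¹ ^ k * R) < 2 * EMetric.diam (univ : Set X) :=
        (ENNReal.ofReal_le_ofReal hle3).trans_lt hRd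
      have hex : ∀ y : X, ∃ H : Finset X, y ∈ F →
          (H.card : ℝ) ≤ 2 ^ (K * s) * (2⁻¹ ^ k * R / r) ^ s ∧
          E ∩ ball y (2⁻¹ ^ k * R) ⊆ ⋃ z ∈ H, ball z r := by
        intro y
        by_cases hy : y ∈ F
        · obtain ⟨H, hH⟩ := ih y (hF1 hy) r (2⁻¹ ^ k * R) hr hle1 hle2 hd
          exact ⟨H, fun _ => hH⟩
        · exact ⟨∅, fun h => absurd h hy⟩
      choose H hH using hex
      refine ⟨F.biUnion H, ?_, ?_⟩
      · have h1 : ((F.biUnion H).card : ℝ) ≤ ∑ y ∈ F, ((H y).card : ℝ) := by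
          exact_mod_cast Finset.card_biUnion_le
        have e1 : (2⁻¹ ^ k * R / r) ^ s = (2⁻¹ ^ k : ℝ) ^ s * (R / r) ^ s := by
          rw [mul_div_assoc, Real.mul_rpow (by positivity) (by positivity)]
        calc ((F.biUnion H).card : ℝ) ≤ ∑ y ∈ F, ((H y).card : ℝ) := h1
          _ ≤ ∑ y ∈ F, 2 ^ (K * s) * (2⁻¹ ^ k * R / r) ^ s :=
              Finset.sum_le_sum fun y hy => (hH y hy).1
          _ = (F.card * (2⁻¹ ^ k : ℝ) ^ s) * (2 ^ (K * s) * (R / r) ^ s) := by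
              rw [Finset.sum_const, nsmul_eq_mul, e1]; ring
          _ ≤ 1 * (2 ^ (K * s) * (R / r) ^ s) := by gcongr
          _ = _ := one_mul _
      · intro z hz
        have h1 := hF2 hz
        simp only [mem_iUnion, exists_prop] at h1
        obtain ⟨y, hy, hzy⟩ := h1
        have h2 := (hH y hy).2 ⟨hz.1, hzy⟩
        simp only [mem_iUnion, exists_prop, Finset.mem_biUnion] at h2 ⊢
        obtain ⟨w, hw, hzw⟩ := h2
        exact ⟨w, ⟨y, hy, hw⟩, hzw⟩
  intro x hx r R hr hrR hRd
  obtain ⟨n, hn⟩ := pow_unbounded_of_one_lt (R / r) (one_lt_two : (1:ℝ) < 2)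
  rw [div_lt_iff₀ hr] at hn
  refine hind n x hx r R hr ?_ hn.le hRd
  have : (2⁻¹ : ℝ) ^ K ≤ 1 := pow_le_one₀ (by norm_num) (by norm_num)
  nlinarith

/-- Lower bound for averages of positive powers of the distance. -/
lemma avg_lower (μ : Measure X) (Q s M b L : ℝ) (hM : 0 < M) (hs : s < Q) (hL0 : 0 < L) (hb : 0 < b)
    (hballs : BallsPosFinite μ)
    (hL : ∀ (x : X) (r : ℝ), 0 < r → ENNReal.ofReal r < 8 * EMetric.diam (univ : Set X) →
        ENNReal.ofReal (L * r ^ Q) ≤ μ (ball x r))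
    (E : Set X)
    (htube : ∀ e ∈ E, ∀ t R : ℝ, 0 < t → t ≤ R →
      μ ({y : X | infDist y E < t} ∩ ball e R) ≤
        ENNReal.ofReal (M * (t / R) ^ (Q - s) * R ^ Q)) :
    ∃ c : ℝ, 0 < c ∧ ∀ x ∈ E, ∀ R : ℝ, 0 < R →
      ENNReal.ofReal R < 8 * EMetric.diam (univ : Set X) →
      ENNReal.ofReal (c * R ^ b) ≤
        (∫⁻ y in ball x R, ENNReal.ofReal (infDist y E) ^ b ∂μ) / μ (ball x R) := by
  set ε : ℝ := min 1 ((L / (2 * M)) ^ (Q - s)⁻¹) with hε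
  have hQs : 0 < Q - s := by linarith
  have hε0 : 0 < ε := lt_min one_pos (by positivity)
  have hε1 : ε ≤ 1 := min_le_left _ _
  have hεM : M * ε ^ (Q - s) ≤ L / 2 := by
    have h1 : ε ^ (Q - s) ≤ ((L / (2 * M)) ^ (Q - s)⁻¹) ^ (Q - s) :=
      Real.rpow_le_rpow hε0.le (min_le_right _ _) hQs.le
    rw [← Real.rpow_mul (by positivity), inv_mul_cancel₀ hQs.ne', Real.rpow_one] at h1
    calc M * ε ^ (Q - s) ≤ M * (L / (2 * M)) := by gcongr
      _ = L / 2 := by field_simp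
  refine ⟨ε ^ b / 2, by positivity, ?_⟩
  intro x hx R hR hR8
  obtain ⟨hB0, hBt⟩ := hballs x R hR
  set B := ball x R
  set T := {y : X | infDist y E < ε * R} ∩ B with hT
  have hTm : MeasurableSet T :=
    ((isOpen_lt (continuous_infDist_pt E) continuous_const).inter isOpen_ball).measurableSet
  have hTle : μ T ≤ μ B / 2 := by
    calc μ T ≤ ENNReal.ofReal (M * (ε * R / R) ^ (Q - s) * R ^ Q) :=
          htube x hx (ε * R) R (by positivity) (by nlinarith)
      _ ≤ ENNReal.ofReal ((L * R ^ Q) / 2) := by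
          apply ENNReal.ofReal_le_ofReal
          rw [mul_div_cancel_right₀ _ hR.ne']
          have : 0 < R ^ Q := by positivity
          nlinarith
      _ = ENNReal.ofReal (L * R ^ Q) / 2 := by
          rw [ENNReal.ofReal_div_of_pos (by norm_num)]; simp
      _ ≤ μ B / 2 := by gcongr; exact hL x R hR hR8
  have hdiff : μ B / 2 ≤ μ (B \ T) := by
    rw [measure_diff inter_subset_right hTm.nullMeasurableSet
      (ne_top_of_le_ne_top hBt.ne (measure_mono inter_subset_right))]
    calc μ B / 2 = μ B - μ B / 2 := (ENNReal.sub_half hBt.ne).symm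
      _ ≤ μ B - μ T := tsub_le_tsub_left hTle _
  rw [ENNReal.le_div_iff_mul_le (Or.inl hB0.ne') (Or.inl hBt.ne)]
  calc ENNReal.ofReal (ε ^ b / 2 * R ^ b) * μ B
      = ENNReal.ofReal ((ε * R) ^ b) * (μ B / 2) := by
        rw [Real.mul_rpow hε0.le hR.le, show ε ^ b / 2 * R ^ b = (ε ^ b * R ^ b) * 2⁻¹ by ring,
          ENNReal.ofReal_mul (by positivity), ENNReal.ofReal_inv_of_pos (by norm_num),
          div_eq_mul_inv, mul_assoc, mul_comm (μ B)]
        simp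
    _ ≤ ENNReal.ofReal ((ε * R) ^ b) * μ (B \ T) := by gcongr
    _ = ∫⁻ _ in B \ T, ENNReal.ofReal ((ε * R) ^ b) ∂μ := (setLIntegral_const _ _).symm
    _ ≤ ∫⁻ y in B \ T, ENNReal.ofReal (infDist y E) ^ b ∂μ := by
        apply setLIntegral_mono' (measurableSet_ball.diff hTm)
        intro y hy
        have h1 : ε * R ≤ infDist y E := by
          by_contra h
          exact hy.2 ⟨not_le.1 h, hy.1⟩
        rw [← ENNReal.ofReal_rpow_of_pos (by positivity)]
        exact ENNReal.rpow_le_rpow (ENNReal.ofReal_le_ofReal h1) hb.le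
    _ ≤ ∫⁻ y in B, ENNReal.ofReal (infDist y E) ^ b ∂μ := lintegral_mono_set diff_subset

lemma forward_key [Nontrivial X] (μ : Measure X) (Q U L s M : ℝ) (hU0 : 0 < U)
    (hL0 : 0 < L) (hM : 0 < M) (hs : s < Q)
    (hballs : BallsPosFinite μ)
    (hU : ∀ (x : X) (r : ℝ), 0 < r → μ (ball x r) ≤ ENNReal.ofReal (U * r ^ Q))
    (hL : ∀ (x : X) (r : ℝ), 0 < r → ENNReal.ofReal r < 8 * EMetric.diam (univ : Set X) →
        ENNReal.ofReal (L * r ^ Q) ≤ μ (ball x r))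
    (E : Set X) (hE : E.Nonempty)
    (htube : ∀ e ∈ E, ∀ t R : ℝ, 0 < t → t ≤ R →
      μ ({y : X | infDist y E < t} ∩ ball e R) ≤
        ENNReal.ofReal (M * (t / R) ^ (Q - s) * R ^ Q))
    (β b q A : ℝ) (hβ : 0 < β) (hb : 0 < b) (hq : 0 < q) (hbq : b * q = β) (hA0 : 0 < A)
    (hA : ∀ x ∈ E, ∀ R : ℝ, 0 < R →
      ((∫⁻ y in ball x R, ENNReal.ofReal (infDist y E) ^ (-β) ∂μ) / μ (ball x R)) *
      ((∫⁻ y in ball x R, ENNReal.ofReal (infDist y E) ^ b ∂μ) / μ (ball x R)) ^ q ≤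
      ENNReal.ofReal A) :
    β < Q - assouadDim E := by
  obtain ⟨c, hc, hlow⟩ := avg_lower μ Q s M b L hM hs hL0 hb hballs hL E htube
  obtain ⟨σ, hσ, hσ2⟩ := exists_lt_of_aikawa μ Q U L (A * (c ^ q)⁻¹ * U) β hβ hL0
    (by positivity) hU hL E hE (by
      intro x hx R hR hR4
      have hR8 : ENNReal.ofReal R < 8 * EMetric.diam (univ : Set X) :=
        hR4.trans_le (by gcongr; norm_num)
      obtain ⟨hB0, hBt⟩ := hballs x R hR
      set I := ∫⁻ y in ball x R, ENNReal.ofReal (infDist y E) ^ (-β) ∂μ with hI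
      have h1 := hlow x hx R hR hR8
      have h2 : I / μ (ball x R) * ENNReal.ofReal (c ^ q * R ^ β) ≤ ENNReal.ofReal A := by
        refine le_trans ?_ (hA x hx R hR)
        gcongr
        have : c ^ q * R ^ β = (c * R ^ b) ^ q := by
          rw [Real.mul_rpow hc.le (by positivity), ← Real.rpow_mul hR.le, hbq]
        rw [this, ← ENNReal.ofReal_rpow_of_pos (by positivity)]
        exact ENNReal.rpow_le_rpow h1 hq.le
      have hp : 0 < c ^ q * R ^ β := by positivity
      rw [← ENNReal.le_div_iff_mul_le (Or.inl (by simpa using hp)) (Or.inl ENNReal.ofReal_ne_top),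
        ← ENNReal.ofReal_div_of_pos hp, ENNReal.div_le_iff hB0.ne' hBt.ne] at h2
      refine h2.trans ((mul_le_mul_right (hU x R hR) _).trans ?_)
      rw [← ENNReal.ofReal_mul (by positivity)]
      apply ENNReal.ofReal_le_ofReal
      rw [Real.rpow_sub hR]
      apply le_of_eq
      field_simp)
  have : assouadDim E ≤ σ := csInf_le ⟨0, fun _ h => h.1⟩ hσ
  linarith

lemma exists_ball_eq [Nontrivial X] (x : X) (r : ℝ) (hr : 0 < r) :
    ∃ r' : ℝ, 0 < r' ∧ ENNReal.ofReal r' < 8 * EMetric.diam (univ : Set X) ∧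
      ball x r = ball x r' := by
  by_cases h : ENNReal.ofReal r < 8 * EMetric.diam (univ : Set X)
  · exact ⟨r, hr, h, rfl⟩
  rw [not_lt] at h
  have hfin : EMetric.diam (univ : Set X) ≠ ∞ := by
    intro h0
    rw [h0] at h
    simp at h
  have hpos : EMetric.diam (univ : Set X) ≠ 0 := by
    obtain ⟨a, b, hab⟩ := exists_pair_ne X
    intro h0
    have : edist a b ≤ EMetric.diam (univ : Set X) :=
      Metric.edist_le_ediam_of_mem (mem_univ a) (mem_univ b)
    rw [h0] at this
    exact hab (edist_le_zero.1 this)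
  set d := (EMetric.diam (univ : Set X)).toReal with hd
  have hd0 : 0 < d := ENNReal.toReal_pos hpos hfin
  have hdd : ENNReal.ofReal d = EMetric.diam (univ : Set X) := ENNReal.ofReal_toReal hfin
  have h8d : 8 * EMetric.diam (univ : Set X) = ENNReal.ofReal (8 * d) := by
    rw [ENNReal.ofReal_mul (by norm_num), hdd]; simp
  have hdist : ∀ y z : X, dist y z ≤ d := by
    intro y z
    have h1 : edist y z ≤ ENNReal.ofReal d := by
      rw [hdd]; exact Metric.edist_le_ediam_of_mem (mem_univ y) (mem_univ z)
    rwa [edist_dist, ENNReal.ofReal_le_ofReal_iff hd0.le] at h1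
  rw [h8d, ENNReal.ofReal_le_ofReal_iff hr.le] at h
  refine ⟨2 * d, by linarith, ?_, ?_⟩
  · rw [h8d]; exact (ENNReal.ofReal_lt_ofReal_iff (by linarith)).2 (by linarith)
  · ext y
    have := hdist y x
    simp only [mem_ball]
    constructor <;> intro <;> linarith

theorem distWeight_memAp_iff_of_ahlforsRegular [Nontrivial X]
    (μ : Measure X) (Q : ℝ) (hQ : 0 < Q)
    (hballs : BallsPosFinite μ) (hdbl : Doubling μ) (hreg : AhlforsRegular μ Q)
    (E : Set X) (hE : E.Nonempty) (hEc : IsClosed E) (hdim : assouadDim E < Q)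
    (α p : ℝ) (hp : 1 < p) :
    MemAp μ (distWeight E α) p ↔
      (1 - p) * (Q - assouadDim E) < α ∧ α < Q - assouadDim E := by
  obtain ⟨U, L, hU0, hL0, hU, hL⟩ := exists_mass_bounds μ Q hQ hdbl hreg
  have hSne : (assouadDimBddSet E).Nonempty :=
    ⟨Q, mem_assouadDimBddSet_Q μ Q U L hQ hU0 hL0 hU hL E⟩
  have hp1 : 0 < p - 1 := by linarith
  have hexp : ∀ y : X, distWeight E α y ^ (-(1 / (p - 1))) =
      ENNReal.ofReal (infDist y E) ^ (-(-α / (p - 1))) := by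
    intro y
    rw [distWeight, ← ENNReal.rpow_mul]
    congr 1
    field_simp
  constructor
  · rintro ⟨-, A, hA0, hA⟩
    simp only [hexp] at hA
    obtain ⟨s, hs, hsQ⟩ := exists_lt_of_csInf_lt hSne hdim
    obtain ⟨hs0, C, hC, hcov⟩ := covAll_of_mem E s hs
    obtain ⟨M, hM, htube⟩ := tube_bound μ Q U hU0 hU E hE s C hC hcov
    have hcod : 0 < Q - assouadDim E := by linarith
    constructor
    · rcases le_or_gt 0 α with hα | hα
      · nlinarith
      · have hβ : 0 < -α / (p - 1) := div_pos (by linarith) hp1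
        have key := forward_key μ Q U L s M hU0 hL0 hM hsQ hballs hU hL E hE htube
          (-α / (p - 1)) (-α) (1 / (p - 1)) (A ^ (1 / (p - 1))) hβ (by linarith) (by positivity)
          (by ring) (by positivity) (by
            intro x _ R hR
            have h1 := ENNReal.rpow_le_rpow (hA x R hR) (z := 1 / (p - 1)) (by positivity)
            rw [ENNReal.mul_rpow_of_nonneg _ _ (by positivity), ← ENNReal.rpow_mul,
              mul_one_div_cancel hp1.ne', ENNReal.rpow_one, ENNReal.ofReal_rpow_of_pos hA0,
              mul_comm] at h1
            exact h1)
        rw [div_lt_iff₀ hp1] at key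
        linarith
    · rcases le_or_gt α 0 with hα | hα
      · linarith
      · exact forward_key μ Q U L s M hU0 hL0 hM hsQ hballs hU hL E hE htube
          α (α / (p - 1)) (p - 1) A hα (by positivity) hp1 (by field_simp) hA0 (by
            intro x _ R hR
            have h1 := hA x R hR
            rw [show -(-α / (p - 1)) = α / (p - 1) by ring] at h1
            exact h1)
  · rintro ⟨h1, h2⟩
    have h1' : -α / (p - 1) < Q - assouadDim E := by
      rw [div_lt_iff₀ hp1]; linarith
    obtain ⟨s, hs, hsm⟩ := exists_lt_of_csInf_lt hSne
      (show sInf (assouadDimBddSet E) < min Q (min (Q - α) (Q - -α / (p - 1))) from by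
        change assouadDim E < _
        rw [lt_min_iff, lt_min_iff]
        exact ⟨hdim, by linarith, by linarith⟩)
    rw [lt_min_iff, lt_min_iff] at hsm
    obtain ⟨hsQ, hsα, hsβ⟩ := hsm
    obtain ⟨hs0, C, hC, hcov⟩ := covAll_of_mem E s hs
    obtain ⟨M, hM, htube⟩ := tube_bound μ Q U hU0 hU E hE s C hC hcov
    have hnull : μ E = 0 := measure_zero_of_tube μ Q s M hsQ E hE htube
    obtain ⟨K₁, hK₁, hb₁⟩ := avg_bound μ Q s M α L hM (by linarith) hL0 hL E hE hEc htube
    obtain ⟨K₂, hK₂, hb₂⟩ := avg_bound μ Q s M (-α / (p - 1)) L hM (by linarith) hL0 hL E hE hEc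
      htube
    refine ⟨⟨?_, ?_, ?_⟩, K₁ * K₂ ^ (p - 1), by positivity, ?_⟩
    · exact ((measurable_infDist).ennreal_ofReal).pow_const _
    · filter_upwards [measure_eq_zero_iff_ae_notMem.1 hnull] with y hy
      have hpos : 0 < infDist y E := (hEc.notMem_iff_infDist_pos hE).1 hy
      rw [distWeight, ENNReal.ofReal_rpow_of_pos hpos]
      exact ⟨ENNReal.ofReal_pos.2 (by positivity), ENNReal.ofReal_ne_top⟩
    · intro x r hr
      obtain ⟨r', hr', h8, hball⟩ := exists_ball_eq x r hr
      rw [hball]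
      exact ne_top_of_le_ne_top (ENNReal.mul_ne_top ENNReal.ofReal_ne_top (hballs x r' hr').2.ne)
        (hb₁ x r' hr' h8)
    · intro x r hr
      obtain ⟨r', hr', h8, hball⟩ := exists_ball_eq x r hr
      rw [hball]
      simp only [hexp]
      obtain ⟨hB0, hBt⟩ := hballs x r' hr'
      have e1 := hb₁ x r' hr' h8
      have e2 := hb₂ x r' hr' h8
      rw [← ENNReal.div_le_iff hB0.ne' hBt.ne] at e1 e2
      have hd0 := infDist_nonneg (x := x) (s := E)
      have hP : 0 < infDist x E + r' := by linarith
      refine (mul_le_mul' e1 (ENNReal.rpow_le_rpow e2 hp1.le)).trans ?_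
      rw [ENNReal.ofReal_rpow_of_pos (by positivity), ← ENNReal.ofReal_mul (by positivity)]
      apply ENNReal.ofReal_le_ofReal
      apply le_of_eq
      rw [Real.mul_rpow hK₂.le (by positivity), ← Real.rpow_mul hP.le,
        show -(-α / (p - 1)) * (p - 1) = α by field_simp]
      have : (infDist x E + r') ^ (-α) * (infDist x E + r') ^ α = 1 := by
        rw [← Real.rpow_add hP]; simp
      calc _ = K₁ * K₂ ^ (p - 1) * ((infDist x E + r') ^ (-α) * (infDist x E + r') ^ α) := by ring
        _ = _ := by rw [this, mul_one]

end
end ApDistance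
end

section
/- Let X be an Ahlfors Q-regular metric measure space, let ∅ ≠ E ⊂ X be a closed set with dim_A(E) < Q, let α ∈ ℝ, and set w = δ_E^{-α}. Then w belongs to the Muckenhoupt class A_1 if and only if 0 ≤ α < Q − dim_A(E). -/
open MeasureTheory Metric Set
open scoped ENNReal NNReal

namespace ApDistance

noncomputable section

variable {X : Type*} [MetricSpace X] [MeasurableSpace X] [BorelSpace X]

set_option linter.deprecated false
set_option linter.unusedSectionVars false

lemma dist_le_of_diam {d : ℝ} (hd : 0 < d)
    (hD : EMetric.diam (univ : Set X) = ENNReal.ofReal d) (x y : X) : dist x y ≤ d := by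
  have h : edist x y ≤ EMetric.diam (univ : Set X) := Metric.edist_le_ediam_of_mem (mem_univ x) (mem_univ y)
  rw [hD, edist_dist] at h
  exact (ENNReal.ofReal_le_ofReal_iff hd.le).1 h

lemma diam_cases [Nontrivial X] : EMetric.diam (univ : Set X) = ∞ ∨
    ∃ d : ℝ, 0 < d ∧ EMetric.diam (univ : Set X) = ENNReal.ofReal d := by
  by_cases h : EMetric.diam (univ : Set X) = ∞
  · exact Or.inl h
  · right
    have h0 : EMetric.diam (univ : Set X) ≠ 0 := by
      obtain ⟨x, y, hxy⟩ := exists_pair_ne X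
      have h1 : edist x y ≤ EMetric.diam (univ : Set X) := Metric.edist_le_ediam_of_mem (mem_univ x) (mem_univ y)
      intro h2
      rw [h2] at h1
      exact hxy (edist_eq_zero.1 (le_antisymm h1 bot_le))
    exact ⟨_, ENNReal.toReal_pos h0 h, (ENNReal.ofReal_toReal h).symm⟩

lemma upper_bound [Nontrivial X] {μ : Measure X} {Q : ℝ} (hQ : 0 < Q)
    (hdbl : Doubling μ) (hreg : AhlforsRegular μ Q) :
    ∃ U : ℝ, 0 < U ∧ ∀ (x : X) (r : ℝ), 0 < r → μ (ball x r) ≤ ENNReal.ofReal (U * r ^ Q) := by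
  obtain ⟨C, hC, hreg⟩ := hreg
  obtain ⟨M, hM, hdbl⟩ := hdbl
  have hC0 : 0 < C := by linarith
  refine ⟨C + M * (M * C), by positivity, fun x r hr => ?_⟩
  have hmono : ENNReal.ofReal (C * r ^ Q) ≤ ENNReal.ofReal ((C + M * (M * C)) * r ^ Q) := by
    apply ENNReal.ofReal_le_ofReal
    have : 0 ≤ M * (M * C) * r ^ Q := by positivity
    linarith [add_mul C (M * (M * C)) (r ^ Q)]
  rcases diam_cases (X := X) with hD | ⟨d, hd, hD⟩
  · exact ((hreg x r hr (by rw [hD]; exact ENNReal.ofReal_lt_top)).2).trans hmono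
  · by_cases hrd : r < d
    · exact ((hreg x r hr (by rw [hD]; exact (ENNReal.ofReal_lt_ofReal_iff hd).2 hrd)).2).trans hmono
    · push Not at hrd
      have h1 : μ (ball x r) ≤ μ (ball x (2 * (2 * (d / 2)))) := by
        apply measure_mono
        intro y _
        rw [mem_ball]
        linarith [dist_le_of_diam hd hD y x]
      have h2 := (hreg x (d / 2) (by positivity)
        (by rw [hD]; exact (ENNReal.ofReal_lt_ofReal_iff hd).2 (by linarith))).2
      have h3 := hdbl x (d / 2) (by positivity)
      have h4 := hdbl x (2 * (d / 2)) (by positivity)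
      calc μ (ball x r) ≤ ENNReal.ofReal M * (ENNReal.ofReal M * ENNReal.ofReal (C * (d / 2) ^ Q)) := by
            refine h1.trans (h4.trans ?_)
            gcongr
            exact h3.trans (by gcongr)
        _ = ENNReal.ofReal (M * (M * (C * (d / 2) ^ Q))) := by
            rw [ENNReal.ofReal_mul hM.le, ENNReal.ofReal_mul hM.le]
        _ ≤ _ := by
            apply ENNReal.ofReal_le_ofReal
            have h5 : (d / 2) ^ Q ≤ r ^ Q := Real.rpow_le_rpow (by positivity) (by linarith) hQ.le
            have h6 : M * (M * (C * (d / 2) ^ Q)) ≤ M * (M * (C * r ^ Q)) := by gcongr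
            have : 0 ≤ C * r ^ Q := by positivity
            nlinarith

lemma lower_bound {μ : Measure X} {Q : ℝ} (hreg : AhlforsRegular μ Q) :
    ∃ L : ℝ, 0 < L ∧ ∀ (x : X) (r : ℝ), 0 < r →
      ENNReal.ofReal r < 8 * EMetric.diam (univ : Set X) →
      ENNReal.ofReal (L * r ^ Q) ≤ μ (ball x r) := by
  obtain ⟨C, hC, hreg⟩ := hreg
  have hC0 : 0 < C := by linarith
  refine ⟨C⁻¹ * (1 / 8 : ℝ) ^ Q, by positivity, fun x r hr hrD => ?_⟩
  have h1 := (hreg x (r / 8) (by positivity) ?_).1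
  · refine le_trans ?_ (h1.trans (measure_mono (ball_subset_ball (by linarith))))
    apply ENNReal.ofReal_le_ofReal
    rw [mul_assoc, ← Real.mul_rpow (by norm_num) hr.le]
    rw [show 1 / 8 * r = r / 8 by ring]
  · rw [ENNReal.ofReal_div_of_pos (by norm_num)]
    apply ENNReal.div_lt_of_lt_mul
    rw [mul_comm] at hrD
    simpa using hrD

/-- two-sided volume bounds used throughout -/
structure Vol (μ : Measure X) (Q U L : ℝ) : Prop where
  Upos : 0 < U
  Lpos : 0 < L
  upper : ∀ (x : X) (r : ℝ), 0 < r → μ (ball x r) ≤ ENNReal.ofReal (U * r ^ Q)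
  lower : ∀ (x : X) (r : ℝ), 0 < r → ENNReal.ofReal r < 8 * EMetric.diam (univ : Set X) →
      ENNReal.ofReal (L * r ^ Q) ≤ μ (ball x r)

lemma ofReal_lt_eight {r R : ℝ} (h : r ≤ 2 * R)
    (hR : ENNReal.ofReal R < 2 * EMetric.diam (univ : Set X)) :
    ENNReal.ofReal r < 8 * EMetric.diam (univ : Set X) := by
  calc ENNReal.ofReal r ≤ ENNReal.ofReal (2 * R) := ENNReal.ofReal_le_ofReal h
    _ = 2 * ENNReal.ofReal R := by rw [ENNReal.ofReal_mul (by norm_num)]; simp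
    _ < 2 * (2 * EMetric.diam (univ : Set X)) :=
      ENNReal.mul_lt_mul_right (by norm_num) (by norm_num) hR
    _ = 4 * EMetric.diam (univ : Set X) := by rw [← mul_assoc]; norm_num
    _ ≤ _ := by gcongr; norm_num

/-- measure of a union of half-balls around a separated set -/
lemma sep_measure {μ : Measure X} {Q U L : ℝ} (hV : Vol μ Q U L) {r R : ℝ} (hr : 0 < r)
    (hrR : r ≤ R) (hR : ENNReal.ofReal R < 2 * EMetric.diam (univ : Set X))
    (S : Finset X) (hsep : ∀ y ∈ S, ∀ z ∈ S, y ≠ z → r ≤ dist y z)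
    (T : Set X) (hT : ∀ y ∈ S, ball y (r / 2) ⊆ T) :
    ENNReal.ofReal (S.card * (L * (r / 2) ^ Q)) ≤ μ T := by
  have hd : (S : Set X).PairwiseDisjoint (fun y => ball y (r / 2)) := by
    intro y hy z hz hyz
    apply ball_disjoint_ball
    linarith [hsep y hy z hz hyz]
  calc ENNReal.ofReal (S.card * (L * (r / 2) ^ Q))
      = ∑ y ∈ S, ENNReal.ofReal (L * (r / 2) ^ Q) := by
        rw [ENNReal.ofReal_mul (by positivity)]; simp
    _ ≤ ∑ y ∈ S, μ (ball y (r / 2)) := by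
        apply Finset.sum_le_sum
        intro y _
        exact hV.lower y _ (by positivity) (ofReal_lt_eight (by linarith) hR)
    _ = μ (⋃ y ∈ S, ball y (r / 2)) :=
        (measure_biUnion_finset hd (fun y _ => measurableSet_ball)).symm
    _ ≤ μ T := measure_mono (iUnion₂_subset hT)

lemma packing {μ : Measure X} {Q U L : ℝ} (hV : Vol μ Q U L) {x : X} {r R : ℝ}
    (hr : 0 < r) (hrR : r ≤ R) (hR : ENNReal.ofReal R < 2 * EMetric.diam (univ : Set X))
    (S : Finset X) (hsep : ∀ y ∈ S, ∀ z ∈ S, y ≠ z → r ≤ dist y z)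
    (hS : ∀ y ∈ S, y ∈ ball x R) :
    (S.card : ℝ) ≤ U / L * 4 ^ Q * (R / r) ^ Q := by
  have hR0 : 0 < R := by linarith
  have hL := hV.Lpos
  have hU := hV.Upos
  have h := sep_measure hV hr hrR hR S hsep (ball x (2 * R)) (fun y hy => by
    apply ball_subset_ball'
    have := mem_ball.1 (hS y hy)
    linarith)
  have h2 := (ENNReal.ofReal_le_ofReal_iff (by positivity)).1
    (h.trans (hV.upper x (2 * R) (by positivity)))
  have e : (2 * R) ^ Q = 4 ^ Q * (R / r) ^ Q * (r / 2) ^ Q := by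
    rw [← Real.mul_rpow (by norm_num) (by positivity), ← Real.mul_rpow (by positivity) (by positivity)]
    congr 1
    field_simp
    norm_num
  rw [e] at h2
  have h3 : 0 < L * (r / 2) ^ Q := by positivity
  rw [← mul_le_mul_iff_left₀ h3]
  refine h2.trans (le_of_eq ?_)
  field_simp

lemma exists_maxsep {μ : Measure X} {Q U L : ℝ} (hV : Vol μ Q U L) (E : Set X) {x : X} {r R : ℝ}
    (hr : 0 < r) (hrR : r ≤ R) (hR : ENNReal.ofReal R < 2 * EMetric.diam (univ : Set X)) :
    ∃ S : Finset X, (∀ y ∈ S, y ∈ E ∩ ball x R) ∧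
      (∀ y ∈ S, ∀ z ∈ S, y ≠ z → r ≤ dist y z) ∧ E ∩ ball x R ⊆ ⋃ y ∈ S, ball y r := by
  classical
  let P : ℕ → Prop := fun k => ∃ S : Finset X, (∀ y ∈ S, y ∈ E ∩ ball x R) ∧
      (∀ y ∈ S, ∀ z ∈ S, y ≠ z → r ≤ dist y z) ∧ S.card = k
  obtain ⟨N, hN⟩ := exists_nat_ge (U / L * 4 ^ Q * (R / r) ^ Q)
  have hb : ∀ k, P k → k ≤ N := by
    rintro k ⟨S, h1, h2, rfl⟩
    have := packing hV hr hrR hR S h2 (fun y hy => (h1 y hy).2)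
    exact_mod_cast this.trans hN
  have h0 : P 0 := ⟨∅, by simp, by simp, by simp⟩
  obtain ⟨S, h1, h2, h3⟩ : P (Nat.findGreatest P N) := Nat.findGreatest_spec (Nat.zero_le N) h0
  refine ⟨S, h1, h2, fun z hz => ?_⟩
  by_contra hcon
  simp only [mem_iUnion, mem_ball, not_exists, not_lt] at hcon
  have hzS : z ∉ S := fun h => by
    have := hcon z h
    rw [dist_self] at this
    linarith
  have hP : P (Nat.findGreatest P N + 1) := by
    refine ⟨insert z S, ?_, ?_, by rw [Finset.card_insert_of_notMem hzS, h3]⟩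
    · intro y hy
      rcases Finset.mem_insert.1 hy with rfl | hy
      · exact hz
      · exact h1 y hy
    · intro y hy y' hy' hne
      rcases Finset.mem_insert.1 hy with h4 | h4
      · rcases Finset.mem_insert.1 hy' with h5 | h5
        · exact absurd (h4.trans h5.symm) hne
        · rw [h4]; exact hcon y' h5
      · rcases Finset.mem_insert.1 hy' with h5 | h5
        · rw [h5, dist_comm]; exact hcon y h4
        · exact h2 y h4 y' h5 hne
  have := Nat.le_findGreatest (hb _ hP) hP
  omega

lemma bddSet_nonempty {μ : Measure X} {Q U L : ℝ} (hQ : 0 < Q) (hV : Vol μ Q U L) (E : Set X) :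
    Q ∈ assouadDimBddSet E := by
  refine ⟨hQ.le, max 1 (U / L * 4 ^ Q), le_max_left _ _, fun x _ r R hr hrR hR => ?_⟩
  obtain ⟨S, h1, h2, h3⟩ := exists_maxsep hV E (x := x) hr hrR.le hR
  refine ⟨S, (packing hV hr hrR.le hR S h2 (fun y hy => (h1 y hy).2)).trans ?_, h3⟩
  have : 0 < R := by linarith
  gcongr
  exact le_max_right _ _

lemma exists_exponent {μ : Measure X} {Q U L : ℝ} (hQ : 0 < Q) (hV : Vol μ Q U L) (E : Set X)
    {t : ℝ} (ht : assouadDim E < t) : ∃ s ∈ assouadDimBddSet E, s < t :=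
  exists_lt_of_csInf_lt ⟨Q, bddSet_nonempty hQ hV E⟩ ht

/-- Covering estimate at all scales. -/
lemma cover_all [Nontrivial X] {E : Set X} {s : ℝ} (hs : s ∈ assouadDimBddSet E) :
    ∃ C : ℝ, 1 ≤ C ∧ ∀ x ∈ E, ∀ r R : ℝ, 0 < r → r ≤ R →
      ∃ F : Finset X, (F.card : ℝ) ≤ C * (R / r) ^ s ∧ E ∩ ball x R ⊆ ⋃ y ∈ F, ball y r := by
  obtain ⟨hs0, C, hC, h⟩ := hs
  refine ⟨C, hC, fun x hx r R hr hrR => ?_⟩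
  have hC0 : 0 < C := by linarith
  have single : E ∩ ball x R ⊆ ball x r →
      ∃ F : Finset X, (F.card : ℝ) ≤ C * (R / r) ^ s ∧ E ∩ ball x R ⊆ ⋃ y ∈ F, ball y r := by
    intro hsub
    refine ⟨{x}, ?_, by simpa using hsub⟩
    have : 1 ≤ (R / r) ^ s := Real.one_le_rpow ((one_le_div hr).2 hrR) hs0
    simp only [Finset.card_singleton, Nat.cast_one]
    nlinarith
  by_cases hR : ENNReal.ofReal R < 2 * EMetric.diam (univ : Set X)
  · rcases hrR.lt_or_eq with hlt | rfl
    · exact h x hx r R hr hlt hR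
    · exact single inter_subset_right
  · rcases diam_cases (X := X) with hD | ⟨d, hd, hD⟩
    · rw [hD] at hR
      exact absurd (by simp [ENNReal.mul_top]) hR
    · have e2 : 2 * EMetric.diam (univ : Set X) = ENNReal.ofReal (2 * d) := by
        rw [hD, ENNReal.ofReal_mul (by norm_num)]; simp
      rw [e2, not_lt, ENNReal.ofReal_le_ofReal_iff (by linarith)] at hR
      have hball : ∀ ρ, d < ρ → ∀ T : Set X, T ⊆ ball x ρ := by
        intro ρ hρ T y _
        rw [mem_ball]
        linarith [dist_le_of_diam hd hD y x]
      by_cases hrd : r < 3 / 2 * d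
      · obtain ⟨F, hF1, hF2⟩ := h x hx r (3 / 2 * d) hr hrd
          (by rw [e2]; exact (ENNReal.ofReal_lt_ofReal_iff (by positivity)).2 (by linarith))
        refine ⟨F, hF1.trans ?_, ?_⟩
        · gcongr
          linarith
        · exact Subset.trans (subset_inter inter_subset_left (hball _ (by linarith) _)) hF2
      · push Not at hrd
        exact single (hball _ (by linarith) _)

/-- Measure of neighbourhoods. -/
lemma nbhd_measure [Nontrivial X] {μ : Measure X} {Q U L : ℝ} (hQ : 0 < Q) (hV : Vol μ Q U L)
    {E : Set X} (hE : E.Nonempty) {s : ℝ} (hs : s ∈ assouadDimBddSet E) :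
    ∃ K : ℝ, 0 < K ∧ ∀ x ∈ E, ∀ r R : ℝ, 0 < r → r ≤ R →
      μ ({y : X | infDist y E < r} ∩ ball x R) ≤ ENNReal.ofReal (K * (r / R) ^ (Q - s) * R ^ Q) := by
  obtain ⟨C, hC, h⟩ := cover_all hs
  have hU := hV.Upos
  refine ⟨C * 2 ^ s * (U * 2 ^ Q), by positivity, fun x hx r R hr hrR => ?_⟩
  have hR : 0 < R := by linarith
  obtain ⟨F, hF1, hF2⟩ := h x hx r (2 * R) hr (by linarith)
  have hsub : {y : X | infDist y E < r} ∩ ball x R ⊆ ⋃ y ∈ F, ball y (2 * r) := by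
    rintro y ⟨hy1, hy2⟩
    obtain ⟨e, heE, hye⟩ := (infDist_lt_iff hE).1 hy1
    have he : e ∈ E ∩ ball x (2 * R) := by
      refine ⟨heE, ?_⟩
      rw [mem_ball] at *
      linarith [dist_triangle e y x, dist_comm e y]
    obtain ⟨z, hz, hez⟩ := mem_iUnion₂.1 (hF2 he)
    refine mem_iUnion₂.2 ⟨z, hz, ?_⟩
    rw [mem_ball] at *
    linarith [dist_triangle y e z]
  calc μ ({y : X | infDist y E < r} ∩ ball x R) ≤ μ (⋃ y ∈ F, ball y (2 * r)) := measure_mono hsub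
    _ ≤ ∑ y ∈ F, μ (ball y (2 * r)) := measure_biUnion_finset_le F _
    _ ≤ ∑ y ∈ F, ENNReal.ofReal (U * (2 * r) ^ Q) :=
        Finset.sum_le_sum (fun y _ => hV.upper y _ (by positivity))
    _ = ENNReal.ofReal (F.card * (U * (2 * r) ^ Q)) := by
        rw [ENNReal.ofReal_mul (p := (F.card : ℝ)) (by positivity)]; simp
    _ ≤ _ := by
        apply ENNReal.ofReal_le_ofReal
        calc (F.card : ℝ) * (U * (2 * r) ^ Q) ≤ C * (2 * R / r) ^ s * (U * (2 * r) ^ Q) := by gcongr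
          _ = _ := by
            have e1 : (2 * R / r) ^ s = 2 ^ s * (r / R) ^ (-s) := by
              rw [Real.rpow_neg (by positivity), ← Real.inv_rpow (by positivity),
                ← Real.mul_rpow (by norm_num) (by positivity)]
              congr 1
              field_simp
            have e2 : (2 * r) ^ Q = 2 ^ Q * ((r / R) ^ Q * R ^ Q) := by
              rw [← Real.mul_rpow (by positivity) (by positivity),
                ← Real.mul_rpow (by positivity) (by positivity)]
              congr 1
              field_simp
            rw [e1, e2, sub_eq_add_neg, Real.rpow_add (by positivity)]
            ring


lemma measurable_distWeight (E : Set X) (α : ℝ) : Measurable (distWeight E α) := by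
  unfold distWeight
  exact (continuous_infDist_pt E).measurable.ennreal_ofReal.pow_const _

lemma distWeight_of_pos {E : Set X} {α : ℝ} {y : X} (h : 0 < infDist y E) :
    distWeight E α y = ENNReal.ofReal (infDist y E ^ (-α)) := by
  unfold distWeight
  rw [ENNReal.ofReal_rpow_of_pos h]

lemma exists_dyadic {δ R : ℝ} (hδ : 0 < δ) (hδR : δ < R) :
    ∃ j : ℕ, R / 2 ^ (j + 1) ≤ δ ∧ δ < R / 2 ^ j := by
  have hR : 0 < R := hδ.trans hδR
  have hex : ∃ n : ℕ, R / 2 ^ n ≤ δ := by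
    obtain ⟨n, hn⟩ := pow_unbounded_of_one_lt (R / δ) (one_lt_two)
    refine ⟨n, ?_⟩
    rw [div_le_iff₀ (by positivity)]
    rw [div_lt_iff₀ hδ] at hn
    linarith
  classical
  have h1 := Nat.find_spec hex
  have h0 : Nat.find hex ≠ 0 := by
    intro h
    rw [h] at h1
    simp at h1
    linarith
  obtain ⟨j, hj⟩ := Nat.exists_eq_succ_of_ne_zero h0
  refine ⟨j, ?_, ?_⟩
  · rw [hj] at h1; exact h1
  · exact not_le.1 (Nat.find_min hex (by omega))

/-- Aikawa-type estimate at all scales. -/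
lemma aikawa [Nontrivial X] {μ : Measure X} {Q U L : ℝ} (hQ : 0 < Q) (hV : Vol μ Q U L)
    {E : Set X} (hE : E.Nonempty) {s : ℝ} (hs : s ∈ assouadDimBddSet E) {α : ℝ} (hα : 0 ≤ α)
    (hαs : α < Q - s) :
    ∃ K : ℝ, 0 < K ∧ ∀ x ∈ E, ∀ R : ℝ, 0 < R →
      ∫⁻ y in ball x R, distWeight E α y ∂μ ≤ ENNReal.ofReal (K * (R ^ Q * R ^ (-α))) := by
  obtain ⟨K, hK, h⟩ := nbhd_measure hQ hV hE hs
  set q : ℝ := (2 : ℝ) ^ (α - (Q - s)) with hq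
  have hq0 : 0 < q := by positivity
  have hq1 : q < 1 := Real.rpow_lt_one_of_one_lt_of_neg (by norm_num) (by linarith)
  have h1q : 0 < 1 - q := by linarith
  refine ⟨2 ^ α * K * (1 - q)⁻¹, by positivity, fun x hx R hR => ?_⟩
  let G : ℕ → Set X := fun j => {y : X | infDist y E < R / 2 ^ j}
  have hG : ∀ j, MeasurableSet (G j) := fun j =>
    (isOpen_lt (continuous_infDist_pt E) continuous_const).measurableSet
  let c : ℕ → ℝ≥0∞ := fun j => ENNReal.ofReal ((R / 2 ^ (j + 1)) ^ (-α))
  have hpt : ∀ y ∈ ball x R, distWeight E α y ≤ ∑' j, (G j).indicator (fun _ => c j) y := by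
    intro y hy
    have hlt : infDist y E < R := (infDist_le_dist_of_mem hx).trans_lt (mem_ball.1 hy)
    rcases (infDist_nonneg (x := y) (s := E)).eq_or_lt with h0 | h0
    · have : ∑' j, (G j).indicator (fun _ => c j) y = ∞ := by
        rw [← top_le_iff]
        rw [← ENNReal.tsum_const_eq_top_of_ne_zero (α := ℕ) (c := ENNReal.ofReal (R ^ (-α)))
          (by simp; positivity)]
        apply ENNReal.tsum_le_tsum
        intro j
        have hy : y ∈ G j := by
          change infDist y E < R / 2 ^ j
          rw [← h0]; positivity
        rw [indicator_of_mem hy]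
        apply ENNReal.ofReal_le_ofReal
        apply Real.rpow_le_rpow_of_nonpos (by positivity) _ (by linarith)
        apply div_le_self hR.le
        exact one_le_pow₀ (by norm_num)
      rw [this]; exact le_top
    · obtain ⟨j, hj1, hj2⟩ := exists_dyadic h0 hlt
      refine le_trans ?_ (ENNReal.le_tsum j)
      rw [indicator_of_mem (show y ∈ G j from hj2), distWeight_of_pos h0]
      apply ENNReal.ofReal_le_ofReal
      exact Real.rpow_le_rpow_of_nonpos (by positivity) hj1 (by linarith)
  calc ∫⁻ y in ball x R, distWeight E α y ∂μ
      ≤ ∫⁻ y in ball x R, ∑' j, (G j).indicator (fun _ => c j) y ∂μ :=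
        setLIntegral_mono' measurableSet_ball hpt
    _ = ∑' j, ∫⁻ y in ball x R, (G j).indicator (fun _ => c j) y ∂μ :=
        lintegral_tsum (fun j => (measurable_const.indicator (hG j)).aemeasurable)
    _ = ∑' j, c j * μ (G j ∩ ball x R) := by
        congr 1; ext j
        rw [lintegral_indicator_const (hG j), Measure.restrict_apply (hG j)]
    _ ≤ ∑' j : ℕ, ENNReal.ofReal (2 ^ α * K * (R ^ Q * R ^ (-α)) * q ^ j) := by
        apply ENNReal.tsum_le_tsum
        intro j
        have h2 : (0:ℝ) < 2 ^ j := by positivity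
        have := h x hx (R / 2 ^ j) R (by positivity) (div_le_self hR.le (one_le_pow₀ (by norm_num)))
        refine (mul_le_mul_right this (c j)).trans (le_of_eq ?_)
        rw [← ENNReal.ofReal_mul (by positivity)]
        congr 1
        have e1 : (R / 2 ^ (j + 1)) ^ (-α) = R ^ (-α) * (((2:ℝ) ^ j) ^ α * 2 ^ α) := by
          rw [Real.div_rpow hR.le (by positivity), Real.rpow_neg (by positivity : (0:ℝ) ≤ 2 ^ (j+1)),
            div_inv_eq_mul, pow_succ, Real.mul_rpow (by positivity) (by norm_num)]
        have e2 : (R / 2 ^ j / R) ^ (Q - s) = ((2:ℝ) ^ j) ^ (-(Q - s)) := by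
          rw [Real.rpow_neg h2.le, ← Real.inv_rpow h2.le]
          congr 1
          field_simp
        have e3 : q ^ j = ((2:ℝ) ^ j) ^ α * ((2:ℝ) ^ j) ^ (-(Q - s)) := by
          rw [← Real.rpow_add h2, hq, ← Real.rpow_natCast, ← Real.rpow_natCast,
            ← Real.rpow_mul (by norm_num), ← Real.rpow_mul (by norm_num)]
          congr 1
          ring
        rw [e1, e2, e3]
        ring
    _ = ENNReal.ofReal (∑' j : ℕ, 2 ^ α * K * (R ^ Q * R ^ (-α)) * q ^ j) := by
        rw [ENNReal.ofReal_tsum_of_nonneg]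
        · intro j; positivity
        · exact (summable_geometric_of_lt_one hq0.le hq1).mul_left _
    _ = _ := by
        rw [tsum_mul_left, tsum_geometric_of_lt_one hq0.le hq1]
        congr 1
        ring

lemma normalize_ball [Nontrivial X] (x : X) {r : ℝ} (hr : 0 < r) :
    ∃ r' : ℝ, 0 < r' ∧ ball x r' = ball x r ∧
      ENNReal.ofReal r' < 8 * EMetric.diam (univ : Set X) := by
  rcases diam_cases (X := X) with hD | ⟨d, hd, hD⟩
  · exact ⟨r, hr, rfl, by rw [hD]; simp [ENNReal.mul_top]⟩
  · have e2 : 8 * EMetric.diam (univ : Set X) = ENNReal.ofReal (8 * d) := by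
      rw [hD, ENNReal.ofReal_mul (by norm_num)]; simp
    have hball : ∀ ρ, d < ρ → ball x ρ = univ := by
      intro ρ hρ
      refine eq_univ_of_forall (fun y => ?_)
      rw [mem_ball]
      linarith [dist_le_of_diam hd hD y x]
    rw [e2]
    by_cases h : r < 8 * d
    · exact ⟨r, hr, rfl, (ENNReal.ofReal_lt_ofReal_iff (by positivity)).2 h⟩
    · refine ⟨2 * d, by positivity, ?_, (ENNReal.ofReal_lt_ofReal_iff (by positivity)).2 (by linarith)⟩
      rw [hball _ (by linarith), hball _ (by linarith)]

/-- Upper bound for the essential supremum of the inverse weight. -/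
lemma essSup_le {μ : Measure X} {E : Set X} {α : ℝ} (hα : 0 ≤ α) {x : X} {r t : ℝ} (ht : 0 < t)
    (h : ∀ y ∈ ball x r, infDist y E ≤ t) :
    essSup (fun y => (distWeight E α y)⁻¹) (μ.restrict (ball x r)) ≤ ENNReal.ofReal (t ^ α) := by
  refine essSup_le_of_ae_le _ ?_
  rw [Filter.EventuallyLE, ae_restrict_iff' measurableSet_ball]
  refine Filter.Eventually.of_forall (fun y hy => ?_)
  unfold distWeight
  rw [← ENNReal.rpow_neg, neg_neg, ← ENNReal.ofReal_rpow_of_pos ht]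
  exact ENNReal.rpow_le_rpow (ENNReal.ofReal_le_ofReal (h y hy)) hα

lemma backward [Nontrivial X] {μ : Measure X} {Q U L : ℝ} (hQ : 0 < Q) (hV : Vol μ Q U L)
    (hballs : BallsPosFinite μ)
    {E : Set X} (hE : E.Nonempty) {s : ℝ} (hs : s ∈ assouadDimBddSet E) {α : ℝ} (hα : 0 ≤ α)
    (hαs : α < Q - s) : MemA1 μ (distWeight E α) := by
  obtain ⟨K, hK, hA⟩ := aikawa hQ hV hE hs hα hαs
  have hL := hV.Lpos
  obtain ⟨z, hz⟩ := hE
  have hfin : ∀ (x : X) (r : ℝ), 0 < r → ∫⁻ y in ball x r, distWeight E α y ∂μ ≠ ∞ := by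
    intro x r hr
    have hsub : ball x r ⊆ ball z (r + dist x z) := ball_subset_ball' le_rfl
    refine ne_top_of_le_ne_top ?_ ((lintegral_mono_set hsub).trans (hA z hz _ ?_))
    · exact ENNReal.ofReal_ne_top
    · have := dist_nonneg (x := x) (y := z)
      linarith
  refine ⟨⟨measurable_distWeight E α, ?_, hfin⟩, ?_⟩
  · have h1 : ∀ᵐ y ∂(μ.restrict (⋃ n : ℕ, ball z ((n : ℝ) + 1))), distWeight E α y < ∞ := by
      rw [ae_restrict_iUnion_iff]
      intro n
      exact ae_lt_top (measurable_distWeight E α) (hfin z _ (by positivity))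
    have h2 : (⋃ n : ℕ, ball z ((n : ℝ) + 1)) = univ := by
      refine eq_univ_of_forall (fun y => ?_)
      obtain ⟨n, hn⟩ := exists_nat_ge (dist y z)
      exact mem_iUnion.2 ⟨n, by rw [mem_ball]; linarith⟩
    rw [h2, Measure.restrict_univ] at h1
    filter_upwards [h1] with y hy
    refine ⟨?_, hy.ne⟩
    unfold distWeight
    rw [ENNReal.rpow_neg, ENNReal.inv_pos]
    exact ENNReal.rpow_ne_top_of_nonneg hα ENNReal.ofReal_ne_top
  · refine ⟨4 ^ α + K * 3 ^ Q / L, by positivity, fun x r₀ hr₀ => ?_⟩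
    obtain ⟨r, hr, hball, hrD⟩ := normalize_ball x hr₀
    rw [← hball]
    have hμ := hballs x r hr
    by_cases hcase : 2 * r ≤ infDist x E
    · set δ := infDist x E with hδ
      have hδ0 : 0 < δ := by linarith
      have hlow : ∀ y ∈ ball x r, δ / 2 ≤ infDist y E := by
        intro y hy
        have := infDist_le_infDist_add_dist (s := E) (x := x) (y := y)
        rw [mem_ball, dist_comm] at hy
        linarith
      have hup : ∀ y ∈ ball x r, infDist y E ≤ 2 * δ := by
        intro y hy
        have := infDist_le_infDist_add_dist (s := E) (x := y) (y := x)
        rw [mem_ball] at hy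
        linarith
      have hint : ∫⁻ y in ball x r, distWeight E α y ∂μ ≤
          ENNReal.ofReal ((δ / 2) ^ (-α)) * μ (ball x r) := by
        rw [← setLIntegral_const]
        apply setLIntegral_mono' measurableSet_ball
        intro y hy
        have h1 := hlow y hy
        rw [distWeight_of_pos (by linarith)]
        apply ENNReal.ofReal_le_ofReal
        exact Real.rpow_le_rpow_of_nonpos (by positivity) h1 (by linarith)
      calc _ ≤ ENNReal.ofReal ((δ / 2) ^ (-α)) * ENNReal.ofReal ((2 * δ) ^ α) := by
            gcongr
            · exact ENNReal.div_le_of_le_mul hint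
            · exact essSup_le hα (by positivity) hup
        _ = ENNReal.ofReal (4 ^ α) := by
            rw [← ENNReal.ofReal_mul (by positivity), Real.rpow_neg (by positivity),
              ← Real.inv_rpow (by positivity), ← Real.mul_rpow (by positivity) (by positivity)]
            congr 2
            field_simp
            norm_num
        _ ≤ _ := ENNReal.ofReal_le_ofReal (le_add_of_nonneg_right (by positivity))
    · push Not at hcase
      obtain ⟨e, he, hxe⟩ := (infDist_lt_iff ⟨z, hz⟩).1 hcase
      have hsub : ball x r ⊆ ball e (3 * r) := ball_subset_ball' (by linarith)
      have hint := (lintegral_mono_set (f := distWeight E α) (μ := μ) hsub).trans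
        (hA e he (3 * r) (by positivity))
      have hup : ∀ y ∈ ball x r, infDist y E ≤ 3 * r := fun y hy =>
        (infDist_le_dist_of_mem he).trans (mem_ball.1 (hsub hy)).le
      have hlow := hV.lower x r hr hrD
      calc _ ≤ ENNReal.ofReal (K * ((3 * r) ^ Q * (3 * r) ^ (-α))) / ENNReal.ofReal (L * r ^ Q) *
              ENNReal.ofReal ((3 * r) ^ α) := by
            gcongr
            exact essSup_le hα (by positivity) hup
        _ = ENNReal.ofReal (K * 3 ^ Q / L) := by
            rw [← ENNReal.ofReal_div_of_pos (by positivity), ← ENNReal.ofReal_mul (by positivity),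
              Real.rpow_neg (by positivity), Real.mul_rpow (z := Q) (by positivity) (by positivity)]
            congr 1
            have h3 : (0:ℝ) < (3 * r) ^ α := by positivity
            have h4 : (0:ℝ) < r ^ Q := by positivity
            field_simp
        _ ≤ _ := ENNReal.ofReal_le_ofReal (le_add_of_nonneg_left (by positivity))


lemma le_essSup_of {μ : Measure X} {f : X → ℝ≥0∞} {x : X} {r : ℝ} {c : ℝ≥0∞} (T : Set X)
    (hT : T ⊆ ball x r) (hμ : 0 < μ T) (h : ∀ y ∈ T, c ≤ f y) :
    c ≤ essSup f (μ.restrict (ball x r)) := by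
  by_contra hcon
  push Not at hcon
  have h1 := ae_lt_of_essSup_lt hcon
  rw [ae_restrict_iff' measurableSet_ball] at h1
  have h2 : ∀ᵐ y ∂μ, y ∉ T := by
    filter_upwards [h1] with y hy hyT
    exact absurd (hy (hT hyT)) (not_lt.2 (h y hyT))
  exact hμ.ne' (measure_eq_zero_iff_ae_notMem.2 h2)

lemma inv_distWeight (E : Set X) (α : ℝ) (y : X) :
    (distWeight E α y)⁻¹ = ENNReal.ofReal (infDist y E) ^ α := by
  unfold distWeight
  rw [← ENNReal.rpow_neg, neg_neg]

lemma forward_nonneg {μ : Measure X} (hballs : BallsPosFinite μ)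
    {E : Set X} (hE : E.Nonempty) {α : ℝ} (h : MemA1 μ (distWeight E α)) : 0 ≤ α := by
  by_contra hα
  push Not at hα
  obtain ⟨⟨hmeas, hpos, -⟩, A, hA, h⟩ := h
  obtain ⟨x, hx⟩ := hE
  have h1 := h x 1 one_pos
  have hμ := hballs x 1 one_pos
  have hI : ∫⁻ y in ball x 1, distWeight E α y ∂μ ≠ 0 := by
    intro h0
    rw [lintegral_eq_zero_iff hmeas, Filter.EventuallyEq, ae_restrict_iff' measurableSet_ball] at h0
    have h2 : ∀ᵐ y ∂μ, y ∉ ball x 1 := by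
      filter_upwards [h0, hpos] with y hy hy2 hyT
      exact hy2.1.ne' (hy hyT)
    exact hμ.1.ne' (measure_eq_zero_iff_ae_notMem.2 h2)
  have hS : essSup (fun y => (distWeight E α y)⁻¹) (μ.restrict (ball x 1)) ≠ ∞ := by
    intro hS
    rw [hS, ENNReal.mul_top (ENNReal.div_ne_zero.2 ⟨hI, hμ.2.ne⟩)] at h1
    exact ENNReal.ofReal_ne_top (top_le_iff.1 h1)
  set B := (essSup (fun y => (distWeight E α y)⁻¹) (μ.restrict (ball x 1))).toReal with hB
  have hB0 : 0 ≤ B := ENNReal.toReal_nonneg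
  set ε : ℝ := (B + 1) ^ (1 / α) with hε
  have hε0 : 0 < ε := by positivity
  have hε1 : ε ≤ 1 := Real.rpow_le_one_of_one_le_of_nonpos (by linarith)
    (div_nonpos_of_nonneg_of_nonpos one_pos.le hα.le)
  have hεα : ε ^ α = B + 1 := by
    rw [hε, ← Real.rpow_mul (by positivity), one_div, inv_mul_cancel₀ hα.ne, Real.rpow_one]
  have h3 : ENNReal.ofReal (B + 1) ≤
      essSup (fun y => (distWeight E α y)⁻¹) (μ.restrict (ball x 1)) := by
    apply le_essSup_of (ball x ε) (ball_subset_ball hε1) (hballs x ε hε0).1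
    intro y hy
    rw [inv_distWeight, ← hεα, ← ENNReal.ofReal_rpow_of_pos hε0]
    have h4 : infDist y E ≤ ε := (infDist_le_dist_of_mem hx).trans (mem_ball.1 hy).le
    rw [← neg_neg α, ENNReal.rpow_neg _ (-α), ENNReal.rpow_neg _ (-α), ENNReal.inv_le_inv]
    exact ENNReal.rpow_le_rpow (ENNReal.ofReal_le_ofReal h4) (by linarith)
  rw [← ENNReal.ofReal_toReal hS, ENNReal.ofReal_le_ofReal_iff hB0] at h3
  linarith

lemma porous [Nontrivial X] {μ : Measure X} {Q U L : ℝ} (hQ : 0 < Q) (hV : Vol μ Q U L)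
    {E : Set X} (hE : E.Nonempty) {s : ℝ} (hs : s ∈ assouadDimBddSet E) (hsQ : s < Q) :
    ∃ ε : ℝ, 0 < ε ∧ ∀ x ∈ E, ∀ R : ℝ, 0 < R →
      ENNReal.ofReal R < 2 * EMetric.diam (univ : Set X) →
      0 < μ ({y : X | ε * R ≤ infDist y E} ∩ ball x R) := by
  obtain ⟨K, hK, h⟩ := nbhd_measure hQ hV hE hs
  have hL := hV.Lpos
  set ε : ℝ := min 1 ((L / (2 * K)) ^ (1 / (Q - s))) with hε
  have hε0 : 0 < ε := lt_min one_pos (by positivity)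
  have hQs : 0 < Q - s := by linarith
  have hε1 : ε ^ (Q - s) ≤ L / (2 * K) := by
    calc ε ^ (Q - s) ≤ ((L / (2 * K)) ^ (1 / (Q - s))) ^ (Q - s) :=
          Real.rpow_le_rpow hε0.le (min_le_right _ _) hQs.le
      _ = _ := by
        rw [← Real.rpow_mul (by positivity), one_div, inv_mul_cancel₀ hQs.ne', Real.rpow_one]
  refine ⟨ε, hε0, fun x hx R hR hRD => ?_⟩
  by_contra hcon
  have h0 : μ ({y : X | ε * R ≤ infDist y E} ∩ ball x R) = 0 := by simpa using hcon
  have h1 := h x hx (ε * R) R (by positivity) (by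
    have : ε ≤ 1 := min_le_left _ _
    nlinarith)
  have h2 := hV.lower x R hR (ofReal_lt_eight (by linarith) hRD)
  have h3 : μ (ball x R) ≤ μ ({y : X | infDist y E < ε * R} ∩ ball x R) +
      μ ({y : X | ε * R ≤ infDist y E} ∩ ball x R) := by
    refine (measure_mono ?_).trans (measure_union_le _ _)
    intro y hy
    rcases lt_or_ge (infDist y E) (ε * R) with h | h
    · exact Or.inl ⟨h, hy⟩
    · exact Or.inr ⟨h, hy⟩
  rw [h0, add_zero] at h3
  have h4 := (ENNReal.ofReal_le_ofReal_iff (by positivity)).1 (h2.trans (h3.trans h1))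
  rw [mul_div_assoc, div_self hR.ne', mul_one] at h4
  have hRQ : 0 < R ^ Q := by positivity
  have h5 : L ≤ K * ε ^ (Q - s) := le_of_mul_le_mul_right h4 hRQ
  have h6 : K * ε ^ (Q - s) ≤ K * (L / (2 * K)) := by gcongr
  have h7 : K * (L / (2 * K)) = L / 2 := by field_simp
  linarith

lemma integral_bound [Nontrivial X] {μ : Measure X} {Q U L : ℝ} (hQ : 0 < Q) (hV : Vol μ Q U L)
    (hballs : BallsPosFinite μ)
    {E : Set X} (hE : E.Nonempty) {s : ℝ} (hs : s ∈ assouadDimBddSet E) (hsQ : s < Q)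
    {α : ℝ} (hα : 0 < α) (h : MemA1 μ (distWeight E α)) :
    ∃ K : ℝ, 0 < K ∧ ∀ x ∈ E, ∀ R : ℝ, 0 < R →
      ENNReal.ofReal R < 2 * EMetric.diam (univ : Set X) →
      ∫⁻ y in ball x (2 * R), distWeight E α y ∂μ ≤ ENNReal.ofReal (K * (R ^ Q * R ^ (-α))) := by
  obtain ⟨ε, hε, hpor⟩ := porous hQ hV hE hs hsQ
  obtain ⟨-, A, hA, h⟩ := h
  have hU := hV.Upos
  refine ⟨A * ε ^ (-α) * (U * 2 ^ Q), by positivity, fun x hx R hR hRD => ?_⟩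
  have h1 := h x (2 * R) (by positivity)
  have hμ := hballs x (2 * R) (by positivity)
  have h2 : ENNReal.ofReal ((ε * R) ^ α) ≤
      essSup (fun y => (distWeight E α y)⁻¹) (μ.restrict (ball x (2 * R))) := by
    apply le_essSup_of _ _ (hpor x hx R hR hRD)
    · intro y hy
      rw [inv_distWeight, ← ENNReal.ofReal_rpow_of_pos (by positivity)]
      exact ENNReal.rpow_le_rpow (ENNReal.ofReal_le_ofReal hy.1) hα.le
    · exact inter_subset_right.trans (ball_subset_ball (by linarith))
  have hpos : 0 < (ε * R) ^ α := by positivity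
  have h3 : (∫⁻ y in ball x (2 * R), distWeight E α y ∂μ) / μ (ball x (2 * R)) *
      ENNReal.ofReal ((ε * R) ^ α) ≤ ENNReal.ofReal A := le_trans (by gcongr) h1
  have h4 : (∫⁻ y in ball x (2 * R), distWeight E α y ∂μ) / μ (ball x (2 * R)) ≤
      ENNReal.ofReal (A / (ε * R) ^ α) := by
    rw [ENNReal.ofReal_div_of_pos hpos]
    rwa [ENNReal.le_div_iff_mul_le (Or.inl (by simpa using hpos)) (Or.inl ENNReal.ofReal_ne_top)]
  rw [ENNReal.div_le_iff hμ.1.ne' hμ.2.ne] at h4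
  calc _ ≤ ENNReal.ofReal (A / (ε * R) ^ α) * ENNReal.ofReal (U * (2 * R) ^ Q) :=
        h4.trans (by gcongr; exact hV.upper x _ (by positivity))
    _ = _ := by
      rw [← ENNReal.ofReal_mul (by positivity)]
      congr 1
      rw [div_eq_mul_inv, ← Real.rpow_neg (by positivity), Real.mul_rpow hε.le hR.le,
        Real.mul_rpow (by norm_num) hR.le]
      ring

/-- Pointwise geometric sum bound. -/
lemma geom_point {α : ℝ} (hα : 0 < α) : ∃ K : ℝ, 0 < K ∧ ∀ (n : ℕ) (δ R : ℝ), 0 < δ → 0 < R →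
    (∑ j ∈ Finset.range n, if δ < R / 2 ^ (j + 1) then ((2:ℝ) ^ (j + 1)) ^ α else 0) ≤
      K * (R ^ α * δ ^ (-α)) := by
  set q : ℝ := (2:ℝ) ^ α with hq
  have hq1 : 1 < q := Real.one_lt_rpow (by norm_num) hα
  have hqj : ∀ j : ℕ, ((2:ℝ) ^ j) ^ α = q ^ j := by
    intro j
    rw [hq, ← Real.rpow_natCast, ← Real.rpow_natCast, ← Real.rpow_mul (by norm_num),
      ← Real.rpow_mul (by norm_num), mul_comm]
  have hq0 : 0 < q - 1 := by linarith
  refine ⟨q / (q - 1), by positivity, fun n δ R hδ hR => ?_⟩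
  have hgeo : ∀ m : ℕ, ∑ j ∈ Finset.range m, q ^ (j + 1) ≤ q / (q - 1) * q ^ m := by
    intro m
    induction m with
    | zero => simp; positivity
    | succ m ih =>
      rw [Finset.sum_range_succ]
      have e : q / (q - 1) * q ^ m + q ^ (m + 1) = q / (q - 1) * q ^ (m + 1) := by
        field_simp
        ring
      linarith
  induction n with
  | zero => simp; positivity
  | succ n ih =>
    by_cases hc : δ < R / 2 ^ (n + 1)
    · calc _ ≤ ∑ j ∈ Finset.range (n + 1), q ^ (j + 1) := by
            apply Finset.sum_le_sum
            intro j _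
            rw [hqj]
            split_ifs
            · exact le_rfl
            · positivity
        _ ≤ q / (q - 1) * q ^ (n + 1) := hgeo (n + 1)
        _ ≤ _ := by
            gcongr
            rw [← hqj, Real.rpow_neg hδ.le, ← div_eq_mul_inv, ← Real.div_rpow hR.le hδ.le]
            apply Real.rpow_le_rpow (by positivity) _ hα.le
            rw [le_div_iff₀ hδ]
            rw [lt_div_iff₀ (by positivity)] at hc
            linarith
    · rw [Finset.sum_range_succ, if_neg hc, add_zero]
      exact ih

lemma selection [Nontrivial X] {μ : Measure X} {Q U L : ℝ} (hV : Vol μ Q U L)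
    {E : Set X} {α : ℝ} (hα : 0 < α) {K : ℝ} (hK : 0 < K)
    (hI : ∀ x ∈ E, ∀ R : ℝ, 0 < R → ENNReal.ofReal R < 2 * EMetric.diam (univ : Set X) →
      ∫⁻ y in ball x (2 * R), distWeight E α y ∂μ ≤ ENNReal.ofReal (K * (R ^ Q * R ^ (-α)))) :
    ∃ C : ℝ, 0 < C ∧ ∀ (n : ℕ), ∀ x ∈ E, ∀ R : ℝ, 0 < R →
      ENNReal.ofReal R < 2 * EMetric.diam (univ : Set X) →
      ∀ S : ℕ → Finset X, (∀ j, ∀ y ∈ S j, y ∈ E ∩ ball x R) →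
        (∀ j, ∀ y ∈ S j, ∀ z ∈ S j, y ≠ z → R / 2 ^ (j + 1) ≤ dist y z) →
        ∑ j ∈ Finset.range n, ((S j).card : ℝ) * ((2:ℝ) ^ (j + 1)) ^ (α - Q) ≤ C := by
  obtain ⟨G, hG, hgeo⟩ := geom_point hα
  have hL := hV.Lpos
  refine ⟨G * K * 2 ^ Q / L, by positivity, fun n x hx R hR hRD S hS hsep => ?_⟩
  let T : ℕ → Set X := fun j => {y : X | infDist y E < R / 2 ^ (j + 1)}
  have hT : ∀ j, MeasurableSet (T j) := fun j =>
    (isOpen_lt (continuous_infDist_pt E) continuous_const).measurableSet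
  let c : ℕ → ℝ≥0∞ := fun j => ENNReal.ofReal (((2:ℝ) ^ (j + 1)) ^ α)
  have hpt : ∀ y, ∑ j ∈ Finset.range n, (T j).indicator (fun _ => c j) y ≤
      ENNReal.ofReal (G * R ^ α) * distWeight E α y := by
    intro y
    rcases (infDist_nonneg (x := y) (s := E)).eq_or_lt with h0 | h0
    · have : distWeight E α y = ∞ := by
        unfold distWeight
        rw [← h0, ENNReal.ofReal_zero, ENNReal.zero_rpow_of_neg (by linarith)]
      rw [this, ENNReal.mul_top]
      · exact le_top
      · simp; positivity
    · rw [distWeight_of_pos h0, ← ENNReal.ofReal_mul (by positivity)]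
      have h1 : ∑ j ∈ Finset.range n, (T j).indicator (fun _ => c j) y = ENNReal.ofReal
          (∑ j ∈ Finset.range n,
            if infDist y E < R / 2 ^ (j + 1) then ((2:ℝ) ^ (j + 1)) ^ α else 0) := by
        rw [ENNReal.ofReal_sum_of_nonneg]
        · apply Finset.sum_congr rfl
          intro j _
          by_cases hj : infDist y E < R / 2 ^ (j + 1)
          · rw [if_pos hj, indicator_of_mem (show y ∈ T j from hj)]
          · rw [if_neg hj, indicator_of_notMem (show y ∉ T j from hj), ENNReal.ofReal_zero]
        · intro j _
          split_ifs
          · positivity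
          · exact le_rfl
      rw [h1]
      apply ENNReal.ofReal_le_ofReal
      rw [mul_assoc]
      exact hgeo n _ R h0 hR
  have hmain : ENNReal.ofReal (∑ j ∈ Finset.range n,
      ((2:ℝ) ^ (j + 1)) ^ α * ((S j).card * (L * (R / 2 ^ (j + 1) / 2) ^ Q))) ≤
      ENNReal.ofReal (G * R ^ α) * ENNReal.ofReal (K * (R ^ Q * R ^ (-α))) := by
    calc _ = ∑ j ∈ Finset.range n, c j *
            ENNReal.ofReal ((S j).card * (L * (R / 2 ^ (j + 1) / 2) ^ Q)) := by
          rw [ENNReal.ofReal_sum_of_nonneg (fun j _ => by positivity)]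
          apply Finset.sum_congr rfl
          intro j _
          rw [ENNReal.ofReal_mul (by positivity)]
      _ ≤ ∑ j ∈ Finset.range n, c j * μ (T j ∩ ball x (2 * R)) := by
          apply Finset.sum_le_sum
          intro j _
          gcongr
          have hjR : R / 2 ^ (j + 1) ≤ R := div_le_self hR.le (one_le_pow₀ (by norm_num))
          have hj0 : 0 < R / 2 ^ (j + 1) := by positivity
          apply sep_measure hV hj0 hjR hRD (S j) (hsep j)
          intro y hy z hz
          have hyE := hS j y hy
          have hyx := mem_ball.1 hyE.2
          rw [mem_ball] at hz
          refine ⟨?_, ?_⟩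
          · have := infDist_le_dist_of_mem (x := z) hyE.1
            change infDist z E < R / 2 ^ (j + 1)
            linarith
          · rw [mem_ball]
            linarith [dist_triangle z y x]
      _ = ∑ j ∈ Finset.range n, ∫⁻ y in ball x (2 * R), (T j).indicator (fun _ => c j) y ∂μ := by
          apply Finset.sum_congr rfl
          intro j _
          rw [lintegral_indicator_const (hT j), Measure.restrict_apply (hT j)]
      _ = ∫⁻ y in ball x (2 * R), ∑ j ∈ Finset.range n, (T j).indicator (fun _ => c j) y ∂μ :=
          (lintegral_finset_sum _ (fun j _ => measurable_const.indicator (hT j))).symm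
      _ ≤ ∫⁻ y in ball x (2 * R), ENNReal.ofReal (G * R ^ α) * distWeight E α y ∂μ :=
          lintegral_mono hpt
      _ = ENNReal.ofReal (G * R ^ α) * ∫⁻ y in ball x (2 * R), distWeight E α y ∂μ :=
          lintegral_const_mul _ (measurable_distWeight E α)
      _ ≤ _ := by gcongr; exact hI x hx R hR hRD
  rw [← ENNReal.ofReal_mul (by positivity), ENNReal.ofReal_le_ofReal_iff (by positivity)] at hmain
  have hRQ : 0 < R ^ Q := by positivity
  have e1 : ∑ j ∈ Finset.range n,
      ((2:ℝ) ^ (j + 1)) ^ α * ((S j).card * (L * (R / 2 ^ (j + 1) / 2) ^ Q)) =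
      (∑ j ∈ Finset.range n, ((S j).card : ℝ) * ((2:ℝ) ^ (j + 1)) ^ (α - Q)) *
        (L * R ^ Q / 2 ^ Q) := by
    rw [Finset.sum_mul]
    apply Finset.sum_congr rfl
    intro j _
    rw [Real.div_rpow (by positivity) (by norm_num), Real.div_rpow hR.le (by positivity),
      Real.rpow_sub (by positivity)]
    ring
  have e2 : G * R ^ α * (K * (R ^ Q * R ^ (-α))) = G * K * 2 ^ Q / L * (L * R ^ Q / 2 ^ Q) := by
    rw [Real.rpow_neg hR.le]
    have : 0 < R ^ α := by positivity
    have h2 : (0:ℝ) < 2 ^ Q := by positivity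
    field_simp
  rw [e1, e2] at hmain
  exact le_of_mul_le_mul_right hmain (by positivity)

lemma forward_lt [Nontrivial X] {μ : Measure X} {Q U L : ℝ} (hV : Vol μ Q U L)
    {E : Set X} (hE : E.Nonempty) {α : ℝ} {C : ℝ} (hC : 0 < C)
    (hsel : ∀ (n : ℕ), ∀ x ∈ E, ∀ R : ℝ, 0 < R →
      ENNReal.ofReal R < 2 * EMetric.diam (univ : Set X) →
      ∀ S : ℕ → Finset X, (∀ j, ∀ y ∈ S j, y ∈ E ∩ ball x R) →
        (∀ j, ∀ y ∈ S j, ∀ z ∈ S j, y ≠ z → R / 2 ^ (j + 1) ≤ dist y z) →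
        ∑ j ∈ Finset.range n, ((S j).card : ℝ) * ((2:ℝ) ^ (j + 1)) ^ (α - Q) ≤ C) :
    assouadDim E < Q - α := by
  obtain ⟨n, hn⟩ := exists_nat_ge (2 * C)
  have hn0 : (0:ℝ) < n := by linarith
  set t : ℝ := Q - α - 1 / n with ht
  -- for each ball choose the separated sets
  have hex : ∀ x ∈ E, ∀ R : ℝ, 0 < R → ENNReal.ofReal R < 2 * EMetric.diam (univ : Set X) →
      ∃ S : ℕ → Finset X, (∀ j, ∀ y ∈ S j, y ∈ E ∩ ball x R) ∧
        (∀ j, ∀ y ∈ S j, ∀ z ∈ S j, y ≠ z → R / 2 ^ (j + 1) ≤ dist y z) ∧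
        (∀ j, E ∩ ball x R ⊆ ⋃ y ∈ S j, ball y (R / 2 ^ (j + 1))) := by
    intro x _ R hR hRD
    have := fun j : ℕ => exists_maxsep hV E (x := x) (r := R / 2 ^ (j + 1)) (R := R)
      (by positivity) (div_le_self hR.le (one_le_pow₀ (by norm_num))) hRD
    choose S h1 h2 h3 using this
    exact ⟨S, h1, h2, h3⟩
  -- a good scale
  have hgood : ∀ x ∈ E, ∀ R : ℝ, 0 < R → ENNReal.ofReal R < 2 * EMetric.diam (univ : Set X) →
      ∃ j : ℕ, j < n ∧ ∃ F : Finset X, (∀ y ∈ F, y ∈ E ∩ ball x R) ∧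
        E ∩ ball x R ⊆ (⋃ y ∈ F, ball y (R / 2 ^ (j + 1))) ∧
        (F.card : ℝ) ≤ ((2:ℝ) ^ (j + 1)) ^ t := by
    intro x hx R hR hRD
    obtain ⟨S, h1, h2, h3⟩ := hex x hx R hR hRD
    have hsum := hsel n x hx R hR hRD S h1 h2
    obtain ⟨j, hj, hle⟩ : ∃ j ∈ Finset.range n,
        ((S j).card : ℝ) * ((2:ℝ) ^ (j + 1)) ^ (α - Q) ≤ 1 / 2 := by
      by_contra hcon
      push Not at hcon
      have hne : (Finset.range n).Nonempty := by
        rw [Finset.nonempty_range_iff]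
        rintro rfl
        simp at hn0
      have := Finset.sum_lt_sum_of_nonempty hne hcon
      simp only [Finset.sum_const, Finset.card_range, nsmul_eq_mul] at this
      linarith
    refine ⟨j, Finset.mem_range.1 hj, S j, h1 j, h3 j, ?_⟩
    set b : ℝ := (2:ℝ) ^ (j + 1) with hb
    have hb0 : 0 < b := by positivity
    have hbn : b ^ (1 / (n:ℝ)) ≤ 2 := by
      calc b ^ (1 / (n:ℝ)) ≤ ((2:ℝ) ^ n) ^ (1 / (n:ℝ)) := by
            apply Real.rpow_le_rpow hb0.le _ (by positivity)
            exact pow_le_pow_right₀ (by norm_num) (Finset.mem_range.1 hj)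
        _ = 2 := by
            rw [← Real.rpow_natCast, ← Real.rpow_mul (by norm_num), mul_one_div,
              div_self hn0.ne', Real.rpow_one]
    have e : b ^ t * b ^ (1 / (n:ℝ)) * b ^ (α - Q) = 1 := by
      rw [← Real.rpow_add hb0, ← Real.rpow_add hb0, ht]
      rw [show Q - α - 1 / (n:ℝ) + 1 / n + (α - Q) = 0 by ring, Real.rpow_zero]
    have hbt : 0 < b ^ t := by positivity
    have hbQ : 0 < b ^ (α - Q) := by positivity
    have h5 : 1 ≤ b ^ t * 2 * b ^ (α - Q) := by
      rw [← e]; gcongr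
    have h6 : ((S j).card : ℝ) * b ^ (α - Q) ≤ b ^ t * b ^ (α - Q) := by linarith
    exact le_of_mul_le_mul_right h6 hbQ
  -- the scale n
  have hbase : ∀ x ∈ E, ∀ R : ℝ, 0 < R → ENNReal.ofReal R < 2 * EMetric.diam (univ : Set X) →
      ∃ F : Finset X, E ∩ ball x R ⊆ (⋃ y ∈ F, ball y (R / 2 ^ (n + 1))) ∧
        (F.card : ℝ) ≤ C * ((2:ℝ) ^ (n + 1)) ^ (Q - α) := by
    intro x hx R hR hRD
    obtain ⟨S, h1, h2, h3⟩ := hex x hx R hR hRD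
    have hsum := hsel (n + 1) x hx R hR hRD S h1 h2
    refine ⟨S n, h3 n, ?_⟩
    have h4 := (Finset.single_le_sum (f := fun j => ((S j).card : ℝ) * ((2:ℝ) ^ (j + 1)) ^ (α - Q))
      (fun j _ => by positivity) (Finset.self_mem_range_succ n)).trans hsum
    rw [show α - Q = -(Q - α) by ring, Real.rpow_neg (by positivity), ← div_eq_mul_inv,
      div_le_iff₀ (by positivity)] at h4
    exact h4
  have ht0 : 0 ≤ t := by
    obtain ⟨x, hx⟩ := hE
    obtain ⟨R, hR, hRD⟩ : ∃ R : ℝ, 0 < R ∧ ENNReal.ofReal R < 2 * EMetric.diam (univ : Set X) := by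
      rcases diam_cases (X := X) with hD | ⟨d, hd, hD⟩
      · exact ⟨1, one_pos, by rw [hD]; simp [ENNReal.mul_top]⟩
      · refine ⟨d, hd, ?_⟩
        rw [hD, show (2:ℝ≥0∞) = ENNReal.ofReal 2 by simp, ← ENNReal.ofReal_mul (by norm_num)]
        exact (ENNReal.ofReal_lt_ofReal_iff (by positivity)).2 (by linarith)
    obtain ⟨j, hj, F, hF1, hF2, hF3⟩ := hgood x hx R hR hRD
    obtain ⟨y, hy, -⟩ := mem_iUnion₂.1 (hF2 ⟨hx, mem_ball_self hR⟩)
    have h1 : (1:ℝ) ≤ F.card := by exact_mod_cast Finset.card_pos.2 ⟨y, hy⟩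
    by_contra hneg
    push Not at hneg
    have : ((2:ℝ) ^ (j + 1)) ^ t < 1 :=
      Real.rpow_lt_one_of_one_lt_of_neg (one_lt_pow₀ (by norm_num) (by omega)) hneg
    linarith
  set K : ℝ := max 1 (C * ((2:ℝ) ^ (n + 1)) ^ (Q - α)) with hK
  have hK1 : 1 ≤ K := le_max_left _ _
  have hiter : ∀ r : ℝ, 0 < r → ∀ m : ℕ, ∀ x ∈ E, ∀ R : ℝ, r ≤ R → R ≤ 2 ^ m * r →
      ENNReal.ofReal R < 2 * EMetric.diam (univ : Set X) →
      ∃ F : Finset X, (F.card : ℝ) ≤ K * (R / r) ^ t ∧ E ∩ ball x R ⊆ ⋃ y ∈ F, ball y r := by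
    classical
    intro r hr m
    have hsmall : ∀ x ∈ E, ∀ R : ℝ, r ≤ R → R ≤ 2 ^ (n + 1) * r →
        ENNReal.ofReal R < 2 * EMetric.diam (univ : Set X) →
        ∃ F : Finset X, (F.card : ℝ) ≤ K * (R / r) ^ t ∧ E ∩ ball x R ⊆ ⋃ y ∈ F, ball y r := by
      intro x hx R hrR hRn hRD
      obtain ⟨F, hF1, hF2⟩ := hbase x hx R (by linarith) hRD
      refine ⟨F, ?_, ?_⟩
      · have h1 : 1 ≤ (R / r) ^ t := Real.one_le_rpow ((one_le_div hr).2 hrR) ht0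
        have h2 : (F.card : ℝ) ≤ K := hF2.trans (le_max_right _ _)
        nlinarith
      · refine hF1.trans (iUnion₂_mono (fun y _ => ball_subset_ball ?_))
        rw [div_le_iff₀ (by positivity)]
        linarith
    induction m with
    | zero =>
      intro x hx R hrR hR hRD
      refine hsmall x hx R hrR (hR.trans ?_) hRD
      gcongr
      · norm_num
      · omega
    | succ m ih =>
      intro x hx R hrR hR hRD
      have hR0 : 0 < R := by linarith
      by_cases hc : R ≤ 2 ^ (n + 1) * r
      · exact hsmall x hx R hrR hc hRD
      · push Not at hc
        obtain ⟨j, hj, F, hF1, hF2, hF3⟩ := hgood x hx R hR0 hRD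
        have hb0 : (0:ℝ) < 2 ^ (j + 1) := by positivity
        have hsub : ∀ y ∈ F, ∃ F' : Finset X, (F'.card : ℝ) ≤ K * (R / 2 ^ (j + 1) / r) ^ t ∧
            E ∩ ball y (R / 2 ^ (j + 1)) ⊆ ⋃ z ∈ F', ball z r := by
          intro y hy
          apply ih y (hF1 y hy).1
          · rw [le_div_iff₀ hb0]
            have : (2:ℝ) ^ (j + 1) ≤ 2 ^ (n + 1) := pow_le_pow_right₀ (by norm_num) (by omega)
            nlinarith
          · rw [div_le_iff₀ hb0]
            have h2 : (1:ℝ) ≤ 2 ^ j := one_le_pow₀ (by norm_num)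
            have h3 : 0 < (2:ℝ) ^ m * r := by positivity
            rw [pow_succ] at hR ⊢
            nlinarith
          · refine lt_of_le_of_lt (ENNReal.ofReal_le_ofReal ?_) hRD
            exact div_le_self hR0.le (one_le_pow₀ (by norm_num))
        choose! g hg1 hg2 using hsub
        refine ⟨F.biUnion g, ?_, ?_⟩
        · calc ((F.biUnion g).card : ℝ) ≤ ∑ y ∈ F, ((g y).card : ℝ) := by
                exact_mod_cast Finset.card_biUnion_le
            _ ≤ ∑ y ∈ F, K * (R / 2 ^ (j + 1) / r) ^ t := Finset.sum_le_sum hg1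
            _ = F.card * (K * (R / 2 ^ (j + 1) / r) ^ t) := by simp
            _ ≤ ((2:ℝ) ^ (j + 1)) ^ t * (K * (R / 2 ^ (j + 1) / r) ^ t) := by gcongr
            _ = K * (R / r) ^ t := by
                rw [mul_left_comm, ← Real.mul_rpow (by positivity) (by positivity)]
                congr 2
                field_simp
        · intro z hz
          obtain ⟨y, hy, hzy⟩ := mem_iUnion₂.1 (hF2 hz)
          obtain ⟨u, hu, hzu⟩ := mem_iUnion₂.1 (hg2 y hy ⟨hz.1, hzy⟩)
          exact mem_iUnion₂.2 ⟨u, Finset.mem_biUnion.2 ⟨y, hy, hu⟩, hzu⟩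
  have hmem : t ∈ assouadDimBddSet E := by
    refine ⟨ht0, K, hK1, fun x hx r R hr hrR hRD => ?_⟩
    obtain ⟨m, hm⟩ := pow_unbounded_of_one_lt (R / r) (one_lt_two)
    rw [div_lt_iff₀ hr] at hm
    exact hiter r hr m x hx R hrR.le hm.le hRD
  have h1 : assouadDim E ≤ t := csInf_le ⟨0, fun s hs => hs.1⟩ hmem
  have h2 : 0 < 1 / (n:ℝ) := by positivity
  linarith

theorem distWeight_memA1_iff_of_ahlforsRegular [Nontrivial X]
    (μ : Measure X) (Q : ℝ) (hQ : 0 < Q)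
    (hballs : BallsPosFinite μ) (hdbl : Doubling μ) (hreg : AhlforsRegular μ Q)
    (E : Set X) (hE : E.Nonempty) (hEc : IsClosed E) (hdim : assouadDim E < Q)
    (α : ℝ) :
    MemA1 μ (distWeight E α) ↔ 0 ≤ α ∧ α < Q - assouadDim E := by
  obtain ⟨U, hU, hup⟩ := upper_bound hQ hdbl hreg
  obtain ⟨L, hL, hlow⟩ := lower_bound hreg
  have hV : Vol μ Q U L := ⟨hU, hL, hup, hlow⟩
  constructor
  · intro h
    have hα := forward_nonneg hballs hE h
    refine ⟨hα, ?_⟩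
    rcases hα.eq_or_lt with h0 | h0
    · rw [← h0]; linarith
    · obtain ⟨s, hs, hsQ⟩ := exists_exponent hQ hV E hdim
      obtain ⟨K, hK, hI⟩ := integral_bound hQ hV hballs hE hs hsQ h0 h
      obtain ⟨C, hC, hsel⟩ := selection hV h0 hK hI
      have := forward_lt hV hE hC hsel
      linarith
  · rintro ⟨hα, hlt⟩
    obtain ⟨s, hs, hsQ⟩ := exists_exponent hQ hV E (t := Q - α) (by linarith)
    exact backward hQ hV hballs hE hs hα (by linarith)

end
end ApDistance
end

section
/- Let ∅ ≠ E ⊂ X be a closed set and let α ≥ 0 satisfy codim_A(E) > α, and set w = δ_E^{-α}. Then w belongs to the Muckenhoupt class A_1 (and consequently to A_p for every 1 ≤ p ≤ ∞). -/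
open MeasureTheory Metric Set
open scoped ENNReal NNReal

namespace ApDistance

noncomputable section

variable {X : Type*} [MetricSpace X] [MeasurableSpace X] [BorelSpace X]

/-- The defining inequality of the lower Assouad codimension, exponent `ρ`, constant `C`. -/
def CodimBound (μ : Measure X) (E : Set X) (ρ C : ℝ) : Prop :=
  ∀ x ∈ E, ∀ r R : ℝ, 0 < r → r < R →
    ENNReal.ofReal R < 2 * EMetric.diam (univ : Set X) →
    μ ({y : X | infDist y E < r} ∩ ball x R) ≤
      ENNReal.ofReal (C * (r / R) ^ ρ) * μ (ball x R)

lemma exists_dyadic_s2 {t : ℝ} (h0 : 0 < t) (h1 : t < 1) :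
    ∃ n : ℕ, (1 / 2 : ℝ) ^ (n + 1) ≤ t ∧ t < (1 / 2 : ℝ) ^ n := by
  classical
  have hex : ∃ n : ℕ, (1 / 2 : ℝ) ^ (n + 1) ≤ t := by
    obtain ⟨n, hn⟩ := exists_pow_lt_of_lt_one h0 (by norm_num : (1 / 2 : ℝ) < 1)
    refine ⟨n, le_trans ?_ hn.le⟩
    exact pow_le_pow_of_le_one (by norm_num) (by norm_num) (Nat.le_succ n)
  refine ⟨Nat.find hex, Nat.find_spec hex, ?_⟩
  rcases Nat.eq_zero_or_pos (Nat.find hex) with h | h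
  · rw [h]; simpa using h1
  · have := Nat.find_min hex (m := Nat.find hex - 1) (by omega)
    rw [Nat.sub_add_cancel h] at this
    exact not_le.mp this

lemma distWeight_le_tsum (E : Set X) {β R : ℝ} (hβ : 0 ≤ β) (hR : 0 < R) (y : X)
    (hy : infDist y E < R) :
    distWeight E β y ≤ ∑' j : ℕ, Set.indicator {y : X | infDist y E < R * (1 / 2) ^ j}
      (fun _ => ENNReal.ofReal ((R * (1 / 2) ^ (j + 1)) ^ (-β))) y := by
  rcases (infDist_nonneg (x := y) (s := E)).eq_or_lt with h | h
  · have htop : (∑' j : ℕ, Set.indicator {y : X | infDist y E < R * (1 / 2) ^ j}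
      (fun _ => ENNReal.ofReal ((R * (1 / 2) ^ (j + 1)) ^ (-β))) y) = ∞ := by
      rw [eq_top_iff, ← ENNReal.tsum_const_eq_top_of_ne_zero (α := ℕ)
        (c := ENNReal.ofReal (R ^ (-β)))]
      · refine ENNReal.tsum_le_tsum fun j => ?_
        rw [Set.indicator_of_mem]
        · apply ENNReal.ofReal_le_ofReal
          apply Real.rpow_le_rpow_of_nonpos (by positivity)
          · have : (1 / 2 : ℝ) ^ (j + 1) ≤ 1 := pow_le_one₀ (by norm_num) (by norm_num)
            nlinarith
          · linarith
        · simp only [mem_setOf_eq, ← h]; positivity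
      · have : 0 < R ^ (-β) := by positivity
        simpa using this
    rw [htop]; exact le_top
  · obtain ⟨n, hn1, hn2⟩ := exists_dyadic_s2 (t := infDist y E / R) (by positivity)
      ((div_lt_one hR).2 hy)
    refine le_trans ?_ (ENNReal.le_tsum n)
    rw [Set.indicator_of_mem]
    · unfold distWeight
      rw [ENNReal.ofReal_rpow_of_pos h]
      apply ENNReal.ofReal_le_ofReal
      apply Real.rpow_le_rpow_of_nonpos (by positivity)
      · rw [le_div_iff₀ hR] at hn1; linarith
      · linarith
    · rw [div_lt_iff₀ hR] at hn2
      simp only [mem_setOf_eq]; linarith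

lemma dyadic_identity {β ρ R C : ℝ} (hR : 0 < R) (j : ℕ) :
    (R * (1 / 2) ^ (j + 1)) ^ (-β) * (C * ((1 / 2 : ℝ) ^ j) ^ ρ) =
      R ^ (-β) * (C * (1 / 2 : ℝ) ^ (-β)) * ((1 / 2 : ℝ) ^ (ρ - β)) ^ j := by
  rw [Real.mul_rpow hR.le (by positivity), pow_succ, Real.mul_rpow (by positivity) (by norm_num)]
  have e : ((1 / 2 : ℝ) ^ (ρ - β)) ^ j = ((1 / 2 : ℝ) ^ j) ^ (-β) * ((1 / 2 : ℝ) ^ j) ^ ρ := by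
    rw [← Real.rpow_natCast, ← Real.rpow_mul (by norm_num), ← Real.rpow_add (by positivity),
      ← Real.rpow_natCast, ← Real.rpow_mul (by norm_num)]
    congr 1; ring
  rw [e]; ring

lemma aikawa_s2 (μ : Measure X) (E : Set X) {β ρ C : ℝ} (hβ : 0 ≤ β) (hβρ : β < ρ)
    (hC : 1 ≤ C) (hcod : CodimBound μ E ρ C) :
    ∃ A : ℝ≥0∞, A ≠ ∞ ∧ ∀ z ∈ E, ∀ R : ℝ, 0 < R →
      ENNReal.ofReal R < 2 * EMetric.diam (univ : Set X) →
      ∫⁻ y in ball z R, distWeight E β y ∂μ ≤ A * ENNReal.ofReal (R ^ (-β)) * μ (ball z R) := by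
  set q : ℝ≥0∞ := ENNReal.ofReal ((1 / 2 : ℝ) ^ (ρ - β)) with hq
  have hq1 : q < 1 := by
    rw [hq, ENNReal.ofReal_lt_one]
    exact Real.rpow_lt_one (by norm_num) (by norm_num) (by linarith)
  refine ⟨ENNReal.ofReal (C * (1 / 2 : ℝ) ^ (-β)) * (1 - q)⁻¹, ?_, ?_⟩
  · apply ENNReal.mul_ne_top ENNReal.ofReal_ne_top
    rw [ENNReal.inv_ne_top]
    exact (tsub_pos_of_lt hq1).ne'
  intro z hz R hR hRd
  have hmeas : ∀ j : ℕ, MeasurableSet {y : X | infDist y E < R * (1 / 2) ^ j} := fun j =>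
    measurableSet_lt measurable_infDist measurable_const
  calc ∫⁻ y in ball z R, distWeight E β y ∂μ
      ≤ ∫⁻ y in ball z R, ∑' j : ℕ, Set.indicator {y : X | infDist y E < R * (1 / 2) ^ j}
          (fun _ => ENNReal.ofReal ((R * (1 / 2) ^ (j + 1)) ^ (-β))) y ∂μ := by
        refine setLIntegral_mono' measurableSet_ball fun y hy => ?_
        exact distWeight_le_tsum E hβ hR y ((infDist_le_dist_of_mem hz).trans_lt hy)
    _ = ∑' j : ℕ, ENNReal.ofReal ((R * (1 / 2) ^ (j + 1)) ^ (-β)) *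
          μ ({y : X | infDist y E < R * (1 / 2) ^ j} ∩ ball z R) := by
        rw [lintegral_tsum fun j => (measurable_const.indicator (hmeas j)).aemeasurable]
        congr 1; ext j
        rw [lintegral_indicator (hmeas j), setLIntegral_const, Measure.restrict_apply (hmeas j)]
    _ ≤ ∑' j : ℕ, (ENNReal.ofReal (R ^ (-β)) * ENNReal.ofReal (C * (1 / 2 : ℝ) ^ (-β)) *
          μ (ball z R)) * q ^ j := by
        refine ENNReal.tsum_le_tsum fun j => ?_
        have key : μ ({y : X | infDist y E < R * (1 / 2) ^ j} ∩ ball z R) ≤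
            ENNReal.ofReal (C * ((1 / 2 : ℝ) ^ j) ^ ρ) * μ (ball z R) := by
          rcases Nat.eq_zero_or_pos j with hj | hj
          · subst hj
            have h1 : (1 : ℝ≥0∞) ≤ ENNReal.ofReal C := by simpa using hC
            calc _ ≤ μ (ball z R) := measure_mono inter_subset_right
              _ ≤ ENNReal.ofReal C * μ (ball z R) := le_mul_of_one_le_left (zero_le) h1
              _ = _ := by simp
          · have hlt : (1 / 2 : ℝ) ^ j < 1 := pow_lt_one₀ (by norm_num) (by norm_num) hj.ne'
            have := hcod z hz (R * (1 / 2) ^ j) R (by positivity) (by nlinarith) hRd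
            rwa [mul_div_cancel_left₀ _ hR.ne'] at this
        calc _ ≤ ENNReal.ofReal ((R * (1 / 2) ^ (j + 1)) ^ (-β)) *
              (ENNReal.ofReal (C * ((1 / 2 : ℝ) ^ j) ^ ρ) * μ (ball z R)) := by gcongr
          _ = ENNReal.ofReal (R ^ (-β) * (C * (1 / 2 : ℝ) ^ (-β)) *
                ((1 / 2 : ℝ) ^ (ρ - β)) ^ j) * μ (ball z R) := by
              rw [← mul_assoc, ← ENNReal.ofReal_mul (by positivity), dyadic_identity hR]
          _ = _ := by
              rw [ENNReal.ofReal_mul (by positivity), ENNReal.ofReal_mul (by positivity),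
                ENNReal.ofReal_pow (by positivity)]
              ring
    _ = _ := by
        rw [ENNReal.tsum_mul_left, ENNReal.tsum_geometric]; ring

lemma doubling_eight (μ : Measure X) {D : ℝ} (hD : DoublingWith μ D) (x : X) {r : ℝ}
    (hr : 0 < r) : μ (ball x (8 * r)) ≤ ENNReal.ofReal D ^ 3 * μ (ball x r) := by
  have h1 := hD x r hr
  have h2 := hD x (2 * r) (by positivity)
  have h3 := hD x (2 * (2 * r)) (by positivity)
  calc μ (ball x (8 * r)) = μ (ball x (2 * (2 * (2 * r)))) := by congr 2; ring
    _ ≤ ENNReal.ofReal D * (ENNReal.ofReal D * (ENNReal.ofReal D * μ (ball x r))) := by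
        refine h3.trans ?_; gcongr; refine h2.trans ?_; gcongr
    _ = _ := by ring

/-- Near `E`, a ball is contained in a comparable ball centred at `E` of admissible radius. -/
lemma exists_center [Nontrivial X] (E : Set X) (hE : E.Nonempty) (x : X) {r : ℝ} (hr : 0 < r)
    (hd : infDist x E < 2 * r) :
    ∃ z ∈ E, ∃ R : ℝ, 0 < R ∧ ENNReal.ofReal R < 2 * EMetric.diam (univ : Set X) ∧
      ball x r ⊆ ball z R ∧ ball z R ⊆ ball x (8 * r) := by
  obtain ⟨z, hz, hzx⟩ := (infDist_lt_iff hE).1 hd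
  refine ⟨z, hz, ?_⟩
  by_cases h : ENNReal.ofReal (3 * r) < 2 * EMetric.diam (univ : Set X)
  · refine ⟨3 * r, by positivity, h, ?_, ?_⟩
    · apply ball_subset_ball'; linarith
    · apply ball_subset_ball'; rw [dist_comm]; linarith
  · have hfin : EMetric.diam (univ : Set X) ≠ ∞ := by
      intro h'; apply h; rw [h', ENNReal.mul_top two_ne_zero]; exact ENNReal.ofReal_lt_top
    set D := (EMetric.diam (univ : Set X)).toReal with hDdef
    have hDe : EMetric.diam (univ : Set X) = ENNReal.ofReal D := (ENNReal.ofReal_toReal hfin).symm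
    obtain ⟨a, b, hab⟩ := exists_pair_ne X
    have hle : ∀ a b : X, dist a b ≤ D := by
      intro a b
      rw [dist_edist]
      exact ENNReal.toReal_mono hfin (EMetric.edist_le_diam_of_mem (mem_univ a) (mem_univ b))
    have hDpos : 0 < D := (dist_pos.2 hab).trans_le (hle a b)
    have h2 : (2 : ℝ≥0∞) * ENNReal.ofReal D = ENNReal.ofReal (2 * D) := by
      rw [ENNReal.ofReal_mul (by norm_num)]; simp
    rw [hDe, h2, not_lt, ENNReal.ofReal_le_ofReal_iff (by positivity)] at h
    refine ⟨3 / 2 * D, by positivity, ?_, ?_, ?_⟩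
    · rw [hDe, h2, ENNReal.ofReal_lt_ofReal_iff (by positivity)]; linarith
    · intro y _; rw [mem_ball]; linarith [hle y z]
    · intro y _; rw [mem_ball]; linarith [hle y x]

/-- The key estimate. -/
lemma key_estimate [Nontrivial X] (μ : Measure X) {D : ℝ} (hD : DoublingWith μ D) (E : Set X)
    (hE : E.Nonempty) {β ρ C : ℝ} (hβ : 0 ≤ β) (hβρ : β < ρ)
    (hC : 1 ≤ C) (hcod : CodimBound μ E ρ C) :
    ∃ A : ℝ≥0∞, A ≠ ∞ ∧ ∀ (x : X) (r : ℝ), 0 < r → ∃ L : ℝ, 0 < L ∧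
      (∀ y ∈ ball x r, infDist y E ≤ L) ∧
      ∫⁻ y in ball x r, distWeight E β y ∂μ ≤ A * ENNReal.ofReal (L ^ (-β)) * μ (ball x r) := by
  obtain ⟨A, hA, hAik⟩ := aikawa_s2 μ E hβ hβρ hC hcod
  refine ⟨A * ENNReal.ofReal D ^ 3 + ENNReal.ofReal (3 ^ β), ?_, ?_⟩
  · exact ENNReal.add_ne_top.2 ⟨ENNReal.mul_ne_top hA (ENNReal.pow_ne_top ENNReal.ofReal_ne_top),
      ENNReal.ofReal_ne_top⟩
  intro x r hr
  rcases lt_or_ge (infDist x E) (2 * r) with hd | hd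
  · obtain ⟨z, hz, R, hR, hRd, h1, h2⟩ := exists_center E hE x hr hd
    refine ⟨R, hR, fun y hy => ?_, ?_⟩
    · exact (infDist_le_dist_of_mem hz).trans (mem_ball.1 (h1 hy)).le
    · calc _ ≤ ∫⁻ y in ball z R, distWeight E β y ∂μ := lintegral_mono_set h1
        _ ≤ A * ENNReal.ofReal (R ^ (-β)) * μ (ball z R) := hAik z hz R hR hRd
        _ ≤ A * ENNReal.ofReal (R ^ (-β)) * (ENNReal.ofReal D ^ 3 * μ (ball x r)) := by
            gcongr; exact (measure_mono h2).trans (doubling_eight μ hD x hr)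
        _ = (A * ENNReal.ofReal D ^ 3) * ENNReal.ofReal (R ^ (-β)) * μ (ball x r) := by ring
        _ ≤ _ := by gcongr; exact le_self_add
  · set d := infDist x E with hdd
    have hdpos : 0 < d := by linarith
    refine ⟨3 / 2 * d, by positivity, fun y hy => ?_, ?_⟩
    · have := infDist_le_infDist_add_dist (s := E) (x := y) (y := x)
      rw [mem_ball] at hy; linarith
    · have hle : ∀ y ∈ ball x r, distWeight E β y ≤
          ENNReal.ofReal (3 ^ β) * ENNReal.ofReal ((3 / 2 * d) ^ (-β)) := by
        intro y hy
        have h1 := infDist_le_infDist_add_dist (s := E) (x := x) (y := y)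
        rw [mem_ball, dist_comm] at hy
        have h2 : d / 2 ≤ infDist y E := by linarith
        unfold distWeight
        rw [ENNReal.ofReal_rpow_of_pos (by linarith), ← ENNReal.ofReal_mul (by positivity)]
        apply ENNReal.ofReal_le_ofReal
        calc infDist y E ^ (-β) ≤ (d / 2) ^ (-β) :=
              Real.rpow_le_rpow_of_nonpos (by positivity) h2 (by linarith)
          _ = 3 ^ β * (3 / 2 * d) ^ (-β) := by
              rw [show 3 / 2 * d = 3 * (d / 2) by ring, Real.mul_rpow (by norm_num) (by positivity),
                ← mul_assoc, ← Real.rpow_add (by norm_num)]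
              simp
      calc _ ≤ ∫⁻ y in ball x r, ENNReal.ofReal (3 ^ β) * ENNReal.ofReal ((3 / 2 * d) ^ (-β)) ∂μ :=
            setLIntegral_mono' measurableSet_ball hle
        _ = ENNReal.ofReal (3 ^ β) * ENNReal.ofReal ((3 / 2 * d) ^ (-β)) * μ (ball x r) := by
            rw [setLIntegral_const]
        _ ≤ _ := by gcongr; exact le_add_self

/-- Lower bound for the weight. -/
lemma le_distWeight (E : Set X) {α L : ℝ} (hα : 0 ≤ α) (hL : 0 < L) {y : X}
    (hy : infDist y E ≤ L) : ENNReal.ofReal (L ^ (-α)) ≤ distWeight E α y := by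
  unfold distWeight
  rw [← ENNReal.ofReal_rpow_of_pos hL, ENNReal.rpow_neg, ENNReal.rpow_neg]
  gcongr

lemma distWeight_isWeight [Nontrivial X] (μ : Measure X) (hballs : BallsPosFinite μ)
    {D : ℝ} (hD : DoublingWith μ D) (E : Set X) (hE : E.Nonempty) {α ρ C : ℝ}
    (hα : 0 ≤ α) (hαρ : α < ρ) (hC : 1 ≤ C) (hcod : CodimBound μ E ρ C) :
    IsWeight μ (distWeight E α) := by
  have hint : ∀ (x : X) (r : ℝ), 0 < r → ∫⁻ y in ball x r, distWeight E α y ∂μ ≠ ∞ := by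
    obtain ⟨A, hA, h⟩ := key_estimate μ hD E hE hα hαρ hC hcod
    intro x r hr
    obtain ⟨L, -, -, hL⟩ := h x r hr
    refine ne_top_of_le_ne_top ?_ hL
    exact ENNReal.mul_ne_top (ENNReal.mul_ne_top hA ENNReal.ofReal_ne_top) (hballs x r hr).2.ne
  refine ⟨measurable_distWeight E α, ?_, hint⟩
  obtain ⟨x, -⟩ := hE
  have hae : ∀ n : ℕ, ∀ᵐ y ∂μ, y ∈ ball x ((n : ℝ) + 1) → distWeight E α y < ∞ := by
    intro n
    rw [← ae_restrict_iff' measurableSet_ball]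
    exact ae_lt_top (measurable_distWeight E α) (hint x _ (by positivity))
  filter_upwards [ae_all_iff.2 hae] with y hy
  constructor
  · unfold distWeight
    rw [pos_iff_ne_zero, ENNReal.rpow_neg, Ne, ENNReal.inv_eq_zero]
    exact ENNReal.rpow_ne_top_of_nonneg hα ENNReal.ofReal_ne_top
  · obtain ⟨n, hn⟩ := exists_nat_gt (dist y x)
    exact (hy n (by rw [mem_ball]; linarith)).ne

lemma le_ofReal_toReal_add_one {A : ℝ≥0∞} (hA : A ≠ ∞) :
    A ≤ ENNReal.ofReal (A.toReal + 1) := by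
  rw [← ENNReal.ofReal_toReal hA]
  apply ENNReal.ofReal_le_ofReal
  simp

lemma avg_le (μ : Measure X) (hballs : BallsPosFinite μ) {x : X} {r : ℝ} (hr : 0 < r)
    {I c : ℝ≥0∞} (h : I ≤ c * μ (ball x r)) : I / μ (ball x r) ≤ c :=
  ENNReal.div_le_of_le_mul h

lemma ofReal_neg_mul {L α : ℝ} (hL : 0 < L) :
    ENNReal.ofReal (L ^ (-α)) * ENNReal.ofReal (L ^ α) = 1 := by
  rw [← ENNReal.ofReal_mul (by positivity), ← Real.rpow_add hL]; simp

lemma inv_distWeight_le (E : Set X) {α L : ℝ} (hα : 0 ≤ α) (hL : 0 < L) {y : X}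
    (hy : infDist y E ≤ L) : (distWeight E α y)⁻¹ ≤ ENNReal.ofReal (L ^ α) := by
  unfold distWeight
  rw [← ENNReal.ofReal_rpow_of_pos hL, ENNReal.rpow_neg, inv_inv]
  gcongr

lemma memA1_aux [Nontrivial X] (μ : Measure X) (hballs : BallsPosFinite μ)
    {D : ℝ} (hD : DoublingWith μ D) (E : Set X) (hE : E.Nonempty) {α ρ C : ℝ}
    (hα : 0 ≤ α) (hαρ : α < ρ) (hC : 1 ≤ C) (hcod : CodimBound μ E ρ C) :
    MemA1 μ (distWeight E α) := by
  refine ⟨distWeight_isWeight μ hballs hD E hE hα hαρ hC hcod, ?_⟩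
  obtain ⟨A, hA, h⟩ := key_estimate μ hD E hE hα hαρ hC hcod
  refine ⟨A.toReal + 1, by positivity, fun x r hr => ?_⟩
  obtain ⟨L, hL, hle, hint⟩ := h x r hr
  have h1 := avg_le μ hballs hr hint
  have h2 : essSup (fun y => (distWeight E α y)⁻¹) (μ.restrict (ball x r)) ≤
      ENNReal.ofReal (L ^ α) := by
    refine essSup_le_of_ae_le _ ?_
    filter_upwards [ae_restrict_mem measurableSet_ball] with y hy
    exact inv_distWeight_le E hα hL (hle y hy)
  calc _ ≤ A * ENNReal.ofReal (L ^ (-α)) * ENNReal.ofReal (L ^ α) := mul_le_mul' h1 h2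
    _ = A := by rw [mul_assoc, ofReal_neg_mul hL, mul_one]
    _ ≤ _ := le_ofReal_toReal_add_one hA

lemma memAp_aux [Nontrivial X] (μ : Measure X) (hballs : BallsPosFinite μ)
    {D : ℝ} (hD : DoublingWith μ D) (E : Set X) (hE : E.Nonempty) {α ρ C : ℝ}
    (hα : 0 ≤ α) (hαρ : α < ρ) (hC : 1 ≤ C) (hcod : CodimBound μ E ρ C)
    (p : ℝ) (hp : 1 < p) :
    MemAp μ (distWeight E α) p := by
  refine ⟨distWeight_isWeight μ hballs hD E hE hα hαρ hC hcod, ?_⟩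
  obtain ⟨A, hA, h⟩ := key_estimate μ hD E hE hα hαρ hC hcod
  refine ⟨A.toReal + 1, by positivity, fun x r hr => ?_⟩
  obtain ⟨L, hL, hle, hint⟩ := h x r hr
  have h1 := avg_le μ hballs hr hint
  have hp' : 0 < p - 1 := by linarith
  have h2 : (∫⁻ y in ball x r, distWeight E α y ^ (-(1 / (p - 1))) ∂μ) ≤
      ENNReal.ofReal (L ^ α) ^ (1 / (p - 1)) * μ (ball x r) := by
    rw [← setLIntegral_const]
    refine setLIntegral_mono' measurableSet_ball fun y hy => ?_
    rw [ENNReal.rpow_neg, ← ENNReal.inv_rpow]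
    exact ENNReal.rpow_le_rpow (inv_distWeight_le E hα hL (hle y hy)) (by positivity)
  have h3 := ENNReal.rpow_le_rpow (avg_le μ hballs hr h2) hp'.le
  rw [← ENNReal.rpow_mul, one_div_mul_cancel hp'.ne', ENNReal.rpow_one] at h3
  calc _ ≤ A * ENNReal.ofReal (L ^ (-α)) * ENNReal.ofReal (L ^ α) := mul_le_mul' h1 h3
    _ = A := by rw [mul_assoc, ofReal_neg_mul hL, mul_one]
    _ ≤ _ := le_ofReal_toReal_add_one hA

lemma memAinfty_aux [Nontrivial X] (μ : Measure X) (hballs : BallsPosFinite μ)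
    {D : ℝ} (hD : DoublingWith μ D) (E : Set X) (hE : E.Nonempty) {α ρ C : ℝ}
    (hα : 0 ≤ α) (hαρ : α < ρ) (hC : 1 ≤ C) (hcod : CodimBound μ E ρ C) :
    MemAinfty μ (distWeight E α) := by
  refine ⟨distWeight_isWeight μ hballs hD E hE hα hαρ hC hcod, ?_⟩
  obtain ⟨p, hp1, hpρ⟩ : ∃ p : ℝ, 1 < p ∧ α * p < ρ := by
    refine ⟨1 + (ρ - α) / (2 * (α + 1)), ?_, ?_⟩
    · have : 0 < (ρ - α) / (2 * (α + 1)) := div_pos (by linarith) (by linarith)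
      linarith
    · have : α * ((ρ - α) / (2 * (α + 1))) < ρ - α := by
        rw [← mul_div_assoc, div_lt_iff₀ (by linarith)]
        nlinarith [mul_nonneg hα (sub_pos.2 hαρ).le]
      linarith
  have hp0 : 0 < p := by linarith
  obtain ⟨A, hA, h⟩ := key_estimate μ hD E hE (mul_nonneg hα hp0.le) hpρ hC hcod
  have hpq := Real.HolderConjugate.conjExponent hp1
  set q := p.conjExponent with hq
  have hq0 : 0 < q := hpq.symm.pos
  have hA' : A ^ (1 / p) ≠ ∞ := ENNReal.rpow_ne_top_of_nonneg (by positivity) hA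
  refine ⟨(A ^ (1 / p)).toReal + 1, 1 / q, by positivity, by positivity, ?_⟩
  intro x r hr F hF hFB
  obtain ⟨L, hL, hle, hint⟩ := h x r hr
  obtain ⟨hm0, hmt⟩ := hballs x r hr
  set m := μ (ball x r) with hm
  have hlow : ENNReal.ofReal (L ^ (-α)) * m ≤ ∫⁻ y in ball x r, distWeight E α y ∂μ := by
    rw [hm, ← setLIntegral_const]
    exact setLIntegral_mono' measurableSet_ball fun y hy => le_distWeight E hα hL (hle y hy)
  have hpow : ∀ y, distWeight E α y ^ p = distWeight E (α * p) y := by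
    intro y; unfold distWeight
    rw [← ENNReal.rpow_mul]; congr 1; ring
  have hold := ENNReal.lintegral_mul_le_Lp_mul_Lq (μ.restrict F) hpq
    (f := distWeight E α) (g := fun _ => 1)
    (measurable_distWeight E α).aemeasurable aemeasurable_const
  simp only [Pi.mul_apply, mul_one, hpow, ENNReal.one_rpow, lintegral_const,
    Measure.restrict_apply MeasurableSet.univ, univ_inter, one_mul] at hold
  have hLp : ENNReal.ofReal (L ^ (-(α * p))) ^ (1 / p) = ENNReal.ofReal (L ^ (-α)) := by
    rw [ENNReal.ofReal_rpow_of_pos (by positivity), ← Real.rpow_mul hL.le]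
    congr 2; field_simp
  have hmm : m = m ^ (1 / p) * m ^ (1 / q) := by
    rw [← ENNReal.rpow_add _ _ hm0.ne' hmt.ne]
    have : 1 / p + 1 / q = 1 := by simpa using hpq.inv_add_inv_eq_one
    rw [this, ENNReal.rpow_one]
  calc ∫⁻ y in F, distWeight E α y ∂μ
      ≤ (∫⁻ y in F, distWeight E (α * p) y ∂μ) ^ (1 / p) * μ F ^ (1 / q) := hold
    _ ≤ (A * ENNReal.ofReal (L ^ (-(α * p))) * m) ^ (1 / p) * μ F ^ (1 / q) := by
        gcongr
        exact (lintegral_mono_set hFB).trans hint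
    _ = A ^ (1 / p) * ENNReal.ofReal (L ^ (-α)) * m ^ (1 / p) * μ F ^ (1 / q) := by
        rw [ENNReal.mul_rpow_of_nonneg _ _ (by positivity),
          ENNReal.mul_rpow_of_nonneg _ _ (by positivity), hLp]
    _ = A ^ (1 / p) * (μ F / m) ^ (1 / q) * (ENNReal.ofReal (L ^ (-α)) * m) := by
        have : μ F ^ (1 / q) = (μ F / m) ^ (1 / q) * m ^ (1 / q) := by
          rw [← ENNReal.mul_rpow_of_nonneg _ _ (by positivity),
            ENNReal.div_mul_cancel hm0.ne' hmt.ne]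
        rw [this]
        calc _ = A ^ (1 / p) * (μ F / m) ^ (1 / q) *
              (ENNReal.ofReal (L ^ (-α)) * (m ^ (1 / p) * m ^ (1 / q))) := by ring
          _ = _ := by rw [← hmm]
    _ ≤ _ := by
        gcongr
        exact le_ofReal_toReal_add_one hA'

theorem distWeight_memA1_of_lt_codim [Nontrivial X]
    (μ : Measure X) (hballs : BallsPosFinite μ) (hdbl : Doubling μ)
    (E : Set X) (hE : E.Nonempty) (hEc : IsClosed E)
    (α : ℝ) (hα : 0 ≤ α) (hcodim : α < assouadCodim μ E) :
    MemA1 μ (distWeight E α) ∧ (∀ p : ℝ, 1 < p → MemAp μ (distWeight E α) p) ∧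
      MemAinfty μ (distWeight E α) := by
  obtain ⟨D, -, hD⟩ := hdbl
  have hne : (assouadCodimBddSet μ E).Nonempty := by
    by_contra hcon
    rw [not_nonempty_iff_eq_empty] at hcon
    rw [assouadCodim, hcon, Real.sSup_empty] at hcodim
    linarith
  obtain ⟨ρ, ⟨-, C, hC, hcod⟩, hαρ⟩ := exists_lt_of_lt_csSup hne hcodim
  exact ⟨memA1_aux μ hballs hD E hE hα hαρ hC hcod,
    fun p hp => memAp_aux μ hballs hD E hE hα hαρ hC hcod p hp,
    memAinfty_aux μ hballs hD E hE hα hαρ hC hcod⟩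

end
end ApDistance
end
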